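/- Let 1 < p < ∞. There exists a Ritt operator T : ℓ² → ℓ² (in particular, a power bounded operator on the complex Hilbert space ℓ²) which is not p-polynomially bounded: for every constant C ≥ 1 there is a complex polynomial φ with ‖φ(T)‖_{B(ℓ²)} > C ‖φ(S)‖_{B(ℓ^p(ℤ))}. -/

import Mathlib

open MeasureTheory Polynomial unitInterval
open scoped ENNReal

/-- The map `k ↦ k - 1` preserves the counting measure on `ℤ`. -/
theorem shift_measurePreserving :
    MeasurePreserving (fun k : ℤ => k - 1) Measure.count Measure.count := by
  constructor
  · exact Measurable.of_discrete
  · ext s hs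
    rw [Measure.map_apply Measurable.of_discrete hs]
    have h : (fun k : ℤ => k - 1) ⁻¹' s = (fun k : ℤ => k + 1) '' s := by
      ext k
      constructor
      · intro hk; exact ⟨k - 1, hk, by ring⟩
      · rintro ⟨a, ha, rfl⟩; simpa using ha
    rw [h, Measure.count_injective_image (fun a b hab => by simpa using hab)]

/-- The shift operator `S` on `ℓ^p(ℤ)`, realized as `L^p` of the counting measure on `ℤ`:
`(S t) k = t (k - 1)`. -/
noncomputable def shiftOp (P : ℝ≥0∞) [Fact (1 ≤ P)] :
    Lp ℂ P (Measure.count : Measure ℤ) →L[ℂ] Lp ℂ P (Measure.count : Measure ℤ) :=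
  (Lp.compMeasurePreservingₗᵢ ℂ (fun k : ℤ => k - 1) shift_measurePreserving).toContinuousLinearMap


/-! ### Part 1: a geometric sum lemma -/

theorem geo_sum_aux (q : ℝ) (hq : 2 ≤ q) (y : ℝ) (hy : 0 < y) (c : ℕ → ℝ)
    (h1 : ∀ j, c j ≤ y * q ^ j) (h2 : ∀ j, c j ≤ 1 / (y * q ^ j)) (K : ℕ) :
    (y * q ^ K ≤ 1 → ∑ j ∈ Finset.range K, c j ≤ y * q ^ K) ∧
    (1 < y * q ^ K → ∑ j ∈ Finset.range K, c j ≤ 4 - 2 / (y * q ^ K)) := by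
  induction K with
  | zero =>
    simp only [Finset.range_zero, Finset.sum_empty, pow_zero, mul_one]
    refine ⟨fun _ => hy.le, fun h => ?_⟩
    have : 2 / y ≤ 2 := by rw [div_le_iff₀ hy]; linarith
    linarith
  | succ K ih =>
    rw [Finset.sum_range_succ]
    set b := y * q ^ K with hb
    have hb0 : 0 < b := by positivity
    have hbs : y * q ^ (K + 1) = q * b := by rw [hb]; ring
    rw [hbs]
    have hc1 := h1 K
    have hc2 := h2 K
    rw [← hb] at hc1 hc2
    have hqb : 2 * b ≤ q * b := by nlinarith
    refine ⟨fun h => ?_, fun h => ?_⟩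
    · have := ih.1 (by linarith)
      linarith
    · by_cases hb1 : b ≤ 1
      · have := ih.1 hb1
        have h3 : 2 / (q * b) ≤ 2 := by
          rw [div_le_iff₀ (by linarith)]; linarith
        linarith
      · push Not at hb1
        have := ih.2 hb1
        have h3 : 2 / (q * b) ≤ 1 / b := by
          rw [div_le_div_iff₀ (by linarith) hb0]; linarith
        have h4 : 2 / b = 1 / b + 1 / b := by ring
        linarith

theorem geo_sum (q : ℝ) (hq : 2 ≤ q) (y : ℝ) (hy : 0 < y) (c : ℕ → ℝ)
    (h1 : ∀ j, c j ≤ y * q ^ j) (h2 : ∀ j, c j ≤ 1 / (y * q ^ j)) (K : ℕ) :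
    ∑ j ∈ Finset.range K, c j ≤ 4 := by
  have h := geo_sum_aux q hq y hy c h1 h2 K
  have hb0 : 0 < y * q ^ K := by positivity
  rcases le_or_gt (y * q ^ K) 1 with hh | hh
  · have := h.1 hh; linarith
  · have := h.2 hh
    have : 0 < 2 / (y * q ^ K) := by positivity
    linarith

/-! ### Part 2: the polynomials -/

/-- Cesàro polynomial. -/
noncomputable def cesP (n : ℕ) : Polynomial ℂ :=
  Polynomial.C ((n : ℂ)⁻¹) * ∑ i ∈ Finset.range n, X ^ i

/-- Test polynomials. -/
noncomputable def testP (N : ℕ) : Polynomial ℂ :=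
  ∑ k ∈ Finset.range N, (cesP (64 ^ (2 * k)) - cesP (64 ^ (2 * k + 1)))

theorem cesP_norm_le {A : Type*} [NormedRing A] [NormOneClass A] [NormedAlgebra ℂ A] (S : A)
    (hS : ‖S‖ ≤ 1) (n : ℕ) : ‖aeval S (cesP n)‖ ≤ 1 := by
  unfold cesP
  simp only [map_mul, map_sum, map_pow, aeval_X, aeval_C]
  rw [← Algebra.smul_def, norm_smul]
  have h : ‖∑ i ∈ Finset.range n, S ^ i‖ ≤ n := by
    refine (norm_sum_le _ _).trans ?_
    calc ∑ i ∈ Finset.range n, ‖S ^ i‖ ≤ ∑ i ∈ Finset.range n, (1 : ℝ) := by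
          refine Finset.sum_le_sum fun i _ => (norm_pow_le _ _).trans (pow_le_one₀ (norm_nonneg _) hS)
      _ = n := by simp
  rcases Nat.eq_zero_or_pos n with h0 | h0
  · subst h0; simp
  · have : (0 : ℝ) < n := by exact_mod_cast h0
    rw [norm_inv, Complex.norm_natCast, inv_mul_le_iff₀ this]
    linarith

theorem testP_norm_le {A : Type*} [NormedRing A] [NormOneClass A] [NormedAlgebra ℂ A] (S : A)
    (hS : ‖S‖ ≤ 1) (N : ℕ) : ‖aeval S (testP N)‖ ≤ 2 * N := by
  unfold testP
  simp only [map_sum, map_sub]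
  refine (norm_sum_le _ _).trans ?_
  calc _ ≤ ∑ k ∈ Finset.range N, (2 : ℝ) := by
        refine Finset.sum_le_sum fun i _ => (norm_sub_le _ _).trans ?_
        have h1 := cesP_norm_le S hS (64 ^ (2 * i))
        have h2 := cesP_norm_le S hS (64 ^ (2 * i + 1))
        linarith
    _ = _ := by simp; ring

theorem cesP_eval (n : ℕ) (z : ℂ) : (cesP n).eval z = (n : ℂ)⁻¹ * ∑ i ∈ Finset.range n, z ^ i := by
  simp [cesP, eval_finsetSum]

theorem cesP_near (n : ℕ) (hn : 0 < n) (z : ℂ) (hz : ‖z‖ ≤ 1) :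
    ‖1 - (cesP n).eval z‖ ≤ n * ‖1 - z‖ := by
  have hn' : (n : ℂ) ≠ 0 := by exact_mod_cast hn.ne'
  have hnr : (0 : ℝ) < n := by exact_mod_cast hn
  have hpow : ∀ i : ℕ, ‖1 - z ^ i‖ ≤ i * ‖1 - z‖ := by
    intro i
    rw [← mul_neg_geom_sum, norm_mul, mul_comm]
    gcongr
    refine (norm_sum_le _ _).trans ?_
    calc ∑ j ∈ Finset.range i, ‖z ^ j‖ ≤ ∑ j ∈ Finset.range i, (1 : ℝ) := by
          refine Finset.sum_le_sum fun j _ => ?_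
          rw [norm_pow]; exact pow_le_one₀ (norm_nonneg _) hz
      _ = i := by simp
  have h : 1 - (cesP n).eval z = (n : ℂ)⁻¹ * ∑ i ∈ Finset.range n, (1 - z ^ i) := by
    rw [cesP_eval, Finset.sum_sub_distrib, mul_sub]
    simp [hn']
  rw [h, norm_mul, norm_inv, Complex.norm_natCast, inv_mul_le_iff₀ hnr]
  refine (norm_sum_le _ _).trans ?_
  calc _ ≤ ∑ i ∈ Finset.range n, (n * ‖1 - z‖) := by
        refine Finset.sum_le_sum fun i hi => (hpow i).trans ?_
        have : (i : ℝ) ≤ n := by exact_mod_cast (Finset.mem_range.1 hi).le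
        gcongr
    _ = _ := by simp

theorem cesP_far (n : ℕ) (hn : 0 < n) (z : ℂ) (hz : ‖z‖ ≤ 1) (hz1 : z ≠ 1) :
    ‖(cesP n).eval z‖ ≤ 2 / (n * ‖1 - z‖) := by
  have hnr : (0 : ℝ) < n := by exact_mod_cast hn
  have hz2 : 0 < ‖1 - z‖ := norm_pos_iff.2 (sub_ne_zero.2 hz1.symm)
  rw [cesP_eval, norm_mul, norm_inv, Complex.norm_natCast, le_div_iff₀ (by positivity)]
  have : (n : ℝ)⁻¹ * ‖∑ i ∈ Finset.range n, z ^ i‖ * (n * ‖1 - z‖)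
      = ‖(1 - z) * ∑ i ∈ Finset.range n, z ^ i‖ := by
    rw [norm_mul]; field_simp
  rw [this, mul_neg_geom_sum]
  refine (norm_sub_le _ _).trans ?_
  rw [norm_one, norm_pow]
  have := pow_le_one₀ (n := n) (norm_nonneg z) hz
  linarith

theorem testP_disc (N : ℕ) (z : ℂ) (hz : ‖z‖ ≤ 1) : ‖(testP N).eval z‖ ≤ 512 := by
  by_cases hz1 : z = 1
  · subst hz1
    have : (testP N).eval 1 = 0 := by
      unfold testP
      rw [eval_finsetSum]
      refine Finset.sum_eq_zero fun k _ => ?_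
      simp [cesP_eval]
    rw [this]; simp
  have hz2 : 0 < ‖1 - z‖ := norm_pos_iff.2 (sub_ne_zero.2 (Ne.symm hz1))
  set t := ‖1 - z‖ with ht
  have key := geo_sum (64 ^ 2) (by norm_num) t hz2
    (fun k => ‖(cesP (64 ^ (2 * k))).eval z - (cesP (64 ^ (2 * k + 1))).eval z‖ / 128) ?_ ?_ N
  · unfold testP
    rw [eval_finsetSum]
    refine (norm_sum_le _ _).trans ?_
    simp only [eval_sub]
    rw [← Finset.sum_div] at key
    linarith
  · intro k
    have h1 := cesP_near (64 ^ (2 * k)) (by positivity) z hz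
    have h2 := cesP_near (64 ^ (2 * k + 1)) (by positivity) z hz
    have h3 := norm_sub_le (1 - (cesP (64 ^ (2 * k + 1))).eval z) (1 - (cesP (64 ^ (2 * k))).eval z)
    rw [show 1 - (cesP (64 ^ (2 * k + 1))).eval z - (1 - (cesP (64 ^ (2 * k))).eval z) =
      (cesP (64 ^ (2 * k))).eval z - (cesP (64 ^ (2 * k + 1))).eval z by ring] at h3
    rw [← ht] at h1 h2
    push_cast at h1 h2
    have e1 : (64:ℝ) ^ (2 * k) = (64 ^ 2) ^ k := pow_mul _ _ _
    have e2 : (64:ℝ) ^ (2 * k + 1) = (64 ^ 2) ^ k * 64 := by rw [pow_succ, pow_mul]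
    rw [e2] at h2
    rw [e1] at h1
    have h5 : (0:ℝ) < (64 ^ 2) ^ k * t := by positivity
    rw [div_le_iff₀ (by norm_num)]
    nlinarith
  · intro k
    have h1 := cesP_far (64 ^ (2 * k)) (by positivity) z hz hz1
    have h2 := cesP_far (64 ^ (2 * k + 1)) (by positivity) z hz hz1
    have h3 := norm_sub_le ((cesP (64 ^ (2 * k))).eval z) ((cesP (64 ^ (2 * k + 1))).eval z)
    rw [← ht] at h1 h2
    push_cast at h1 h2
    have e1 : (64:ℝ) ^ (2 * k) = (64 ^ 2) ^ k := pow_mul _ _ _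
    have e2 : (64:ℝ) ^ (2 * k + 1) = (64 ^ 2) ^ k * 64 := by rw [pow_succ, pow_mul]
    rw [e2] at h2
    rw [e1] at h1
    have h5 : (0:ℝ) < (64 ^ 2) ^ k * t := by positivity
    have h6 : (2:ℝ) / ((64 ^ 2) ^ k * 64 * t) ≤ 2 / ((64 ^ 2) ^ k * t) := by
      gcongr; nlinarith
    have h7 : (2:ℝ) / ((64 ^ 2) ^ k * t) = 2 * (1 / (t * (64 ^ 2) ^ k)) := by
      field_simp
    have h8 : 0 < 1 / (t * (64 ^ 2) ^ k) := by positivity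
    rw [div_le_iff₀ (by norm_num)]
    linarith

/-- The eigenvalues. -/
noncomputable def lamE (j : ℕ) : ℝ := 1 - ((8 : ℝ) ^ (2 * j + 1))⁻¹

/-- Cesàro values at real points. -/
noncomputable def cesR (n : ℕ) (l : ℝ) : ℝ := (n : ℝ)⁻¹ * ∑ i ∈ Finset.range n, l ^ i

theorem cesP_eval_real (n : ℕ) (l : ℝ) : (cesP n).eval (l : ℂ) = (cesR n l : ℝ) := by
  rw [cesP_eval, cesR]; push_cast; rfl

/-- real version of the test values. -/
noncomputable def testR (N : ℕ) (l : ℝ) : ℝ :=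
  ∑ k ∈ Finset.range N, (cesR (64 ^ (2 * k)) l - cesR (64 ^ (2 * k + 1)) l)

theorem testP_eval_real (N : ℕ) (l : ℝ) : (testP N).eval (l : ℂ) = (testR N l : ℝ) := by
  unfold testP testR
  rw [eval_finsetSum]
  push_cast
  refine Finset.sum_congr rfl fun k _ => ?_
  rw [eval_sub, cesP_eval_real, cesP_eval_real]

theorem cesR_closed (n : ℕ) (l : ℝ) (hl : l < 1) : cesR n l = (1 - l ^ n) / (n * (1 - l)) := by
  have : 1 - l ≠ 0 := by linarith
  rw [cesR, ← mul_neg_geom_sum]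
  field_simp

theorem cesR_anti (n q : ℕ) (hn : 0 < n) (hq : 0 < q) (l : ℝ) (h0 : 0 ≤ l) (hl : l < 1) :
    cesR (n * q) l ≤ cesR n l := by
  rw [cesR_closed _ _ hl, cesR_closed _ _ hl]
  have hn' : (0 : ℝ) < n := by exact_mod_cast hn
  have hq' : (0 : ℝ) < q := by exact_mod_cast hq
  have hd : 0 < 1 - l := by linarith
  push_cast
  rw [div_le_div_iff₀ (by positivity) (by positivity)]
  have hb := one_add_mul_le_pow (a := l ^ n - 1) (by have := pow_nonneg h0 n; linarith) q
  rw [show 1 + (l ^ n - 1) = l ^ n by ring, ← pow_mul] at hb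
  have hp : (0:ℝ) < n * (1 - l) := by positivity
  nlinarith

theorem cesR_nonneg (n : ℕ) (l : ℝ) (h0 : 0 ≤ l) : 0 ≤ cesR n l := by
  unfold cesR; positivity

theorem cesR_near (n : ℕ) (hn : 0 < n) (l : ℝ) (h0 : 0 ≤ l) (hl : l < 1) :
    1 - n * (1 - l) ≤ cesR n l := by
  have h := cesP_near n hn (l : ℂ) (by rw [Complex.norm_real, Real.norm_of_nonneg h0]; exact hl.le)
  rw [cesP_eval_real] at h
  rw [← Complex.ofReal_one, ← Complex.ofReal_sub, ← Complex.ofReal_sub, Complex.norm_real,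
    Complex.norm_real, Real.norm_of_nonneg (by linarith : 0 ≤ 1 - l)] at h
  have := (abs_le.1 h).2
  linarith

theorem cesR_far (n : ℕ) (hn : 0 < n) (l : ℝ) (h0 : 0 ≤ l) (hl : l < 1) :
    cesR n l ≤ 1 / (n * (1 - l)) := by
  rw [cesR_closed _ _ hl]
  have hn' : (0 : ℝ) < n := by exact_mod_cast hn
  have hd : 0 < 1 - l := by linarith
  have := pow_nonneg h0 n
  gcongr
  linarith

theorem alt_sum_le (u : ℕ → ℝ) (hu : ∀ j, u (j + 1) ≤ u j) (a m : ℕ) :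
    ∑ k ∈ Finset.range m, (u (2 * (a + k)) - u (2 * (a + k) + 1)) ≤ u (2 * a) - u (2 * (a + m)) := by
  induction m with
  | zero => simp
  | succ m ih =>
    rw [Finset.sum_range_succ]
    have := hu (2 * (a + m) + 1)
    have e : 2 * (a + (m + 1)) = 2 * (a + m) + 1 + 1 := by ring
    rw [e]; linarith

theorem alt_sum_nonneg (u : ℕ → ℝ) (hu : ∀ j, u (j + 1) ≤ u j) (s : Finset ℕ) :
    0 ≤ ∑ k ∈ s, (u (2 * k) - u (2 * k + 1)) :=
  Finset.sum_nonneg fun k _ => by linarith [hu (2 * k)]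

theorem lamE_nonneg (j : ℕ) : 0 ≤ lamE j := by
  unfold lamE
  have : ((8 : ℝ) ^ (2 * j + 1))⁻¹ ≤ 1 := inv_le_one_of_one_le₀ (one_le_pow₀ (by norm_num))
  linarith

theorem lamE_lt_one (j : ℕ) : lamE j < 1 := by
  unfold lamE
  have : 0 < ((8 : ℝ) ^ (2 * j + 1))⁻¹ := by positivity
  linarith

theorem lamE_mono (j : ℕ) : lamE j ≤ lamE (j + 1) := by
  unfold lamE
  have : ((8 : ℝ) ^ (2 * (j + 1) + 1))⁻¹ ≤ ((8 : ℝ) ^ (2 * j + 1))⁻¹ := by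
    gcongr
    · norm_num
    · omega
  linarith

theorem testR_gap (N k : ℕ) (hk : k < N) :
    1 / 2 ≤ testR N (lamE (2 * k)) - testR N (lamE (2 * k + 1)) := by
  have hanti : ∀ i j, cesR (64 ^ (j + 1)) (lamE i) ≤ cesR (64 ^ j) (lamE i) := fun i j => by
    rw [pow_succ]
    exact cesR_anti _ _ (by positivity) (by norm_num) _ (lamE_nonneg _) (lamE_lt_one _)
  have hnear : ∀ i, 7 / 8 ≤ cesR (64 ^ i) (lamE i) := fun i => by
    refine le_trans (le_of_eq ?_) (cesR_near _ (by positivity) _ (lamE_nonneg _) (lamE_lt_one _))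
    unfold lamE
    push_cast
    rw [pow_succ, pow_mul, show (8:ℝ) ^ 2 = 64 by norm_num]
    field_simp
    norm_num
  have hfar : ∀ i, cesR (64 ^ (i + 1)) (lamE i) ≤ 1 / 8 := fun i => by
    refine le_trans (cesR_far _ (by positivity) _ (lamE_nonneg _) (lamE_lt_one _)) (le_of_eq ?_)
    unfold lamE
    push_cast
    rw [pow_succ, pow_succ, pow_mul, show (8:ℝ) ^ 2 = 64 by norm_num]
    field_simp
    norm_num
  have h1 : 3 / 4 ≤ testR N (lamE (2 * k)) := by
    unfold testR
    have := Finset.single_le_sum (s := Finset.range N)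
      (f := fun k' => cesR (64 ^ (2 * k')) (lamE (2 * k)) - cesR (64 ^ (2 * k' + 1)) (lamE (2 * k)))
      (fun i _ => by linarith [hanti (2 * k) (2 * i)]) (Finset.mem_range.2 hk)
    have h2 := hnear (2 * k)
    have h3 := hfar (2 * k)
    linarith
  have h2 : testR N (lamE (2 * k + 1)) ≤ 1 / 4 := by
    unfold testR
    obtain ⟨m, rfl⟩ : ∃ m, N = (k + 1) + m := ⟨N - (k + 1), by omega⟩
    rw [Finset.sum_range_add, Finset.sum_range_succ]
    set u := fun j => cesR (64 ^ j) (lamE (2 * k + 1)) with hu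
    have e1 := alt_sum_le u (hanti (2 * k + 1)) 0 k
    have e2 := alt_sum_le u (hanti (2 * k + 1)) (k + 1) m
    have e3 : u 0 = 1 := by simp [hu, cesR]
    have e4 : 7 / 8 ≤ u (2 * k + 1) := hnear (2 * k + 1)
    have e5 : u (2 * (k + 1)) ≤ 1 / 8 := hfar (2 * k + 1)
    have e6 : 0 ≤ u (2 * (k + 1 + m)) := cesR_nonneg _ _ (lamE_nonneg _)
    simp only [zero_add, mul_zero] at e1
    simp only [hu] at *
    linarith
  linarith

/-! ### Part 3a: real interpolation on `ℤ` -/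

/-- `ℓ^p` energy. -/
noncomputable def en (p : ℝ) (f : ℤ → ℂ) : ℝ≥0∞ := ∑' m, ENNReal.ofReal (‖f m‖ ^ p)

theorem inner_big (r τ x : ℝ) (hr : 0 < r) (hτ : 0 < τ) (hx : 0 ≤ x) :
    ∫⁻ t in Set.Ioi (0 : ℝ), (if τ * t < x then ENNReal.ofReal (t ^ (r - 1)) else 0)
      ≤ ENNReal.ofReal ((x / τ) ^ r / r) := by
  have hy : 0 ≤ x / τ := by positivity
  have h1 : ∫⁻ t in Set.Ioi (0 : ℝ), (if τ * t < x then ENNReal.ofReal (t ^ (r - 1)) else 0)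
      ≤ ∫⁻ t in Set.Ioc (0 : ℝ) (x / τ), ENNReal.ofReal (t ^ (r - 1)) := by
    rw [← lintegral_indicator measurableSet_Ioi, ← lintegral_indicator measurableSet_Ioc]
    refine lintegral_mono fun t => ?_
    by_cases ht : 0 < t
    · by_cases h2 : τ * t < x
      · have : t ≤ x / τ := by rw [le_div_iff₀ hτ]; linarith
        simp [Set.indicator, ht, h2, this]
      · simp [Set.indicator, h2]
    · simp [Set.indicator, ht]
  refine h1.trans ?_
  rw [← ofReal_integral_eq_lintegral_ofReal]
  · rw [← intervalIntegral.integral_of_le hy, integral_rpow (Or.inl (by linarith))]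
    rw [sub_add_cancel, Real.zero_rpow hr.ne', sub_zero]
  · have := (intervalIntegral.intervalIntegrable_rpow' (a := 0) (b := x / τ)
      (r := r - 1) (by linarith))
    exact (intervalIntegrable_iff_integrableOn_Ioc_of_le hy).1 this
  · filter_upwards [ae_restrict_mem measurableSet_Ioc] with t ht
    exact Real.rpow_nonneg ht.1.le _

theorem inner_small (r τ x : ℝ) (hr : 0 < r) (hτ : 0 < τ) (hx : 0 < x) :
    ∫⁻ t in Set.Ioi (0 : ℝ), (if τ * t < x then 0 else ENNReal.ofReal (t ^ (-r - 1)))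
      ≤ ENNReal.ofReal ((x / τ) ^ (-r) / r) := by
  have hy : 0 < x / τ := by positivity
  have h1 : ∫⁻ t in Set.Ioi (0 : ℝ), (if τ * t < x then 0 else ENNReal.ofReal (t ^ (-r - 1)))
      ≤ ∫⁻ t in Set.Ici (x / τ), ENNReal.ofReal (t ^ (-r - 1)) := by
    rw [← lintegral_indicator measurableSet_Ioi, ← lintegral_indicator measurableSet_Ici]
    refine lintegral_mono fun t => ?_
    by_cases ht : 0 < t
    · by_cases h2 : τ * t < x
      · simp [Set.indicator, h2]
      · have : x / τ ≤ t := by rw [div_le_iff₀ hτ]; linarith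
        simp [Set.indicator, ht, h2, this]
    · simp [Set.indicator, ht]
  refine h1.trans ?_
  rw [setLIntegral_congr Ioi_ae_eq_Ici.symm, ← ofReal_integral_eq_lintegral_ofReal]
  · rw [integral_Ioi_rpow_of_lt (by linarith) hy, sub_add_cancel, neg_div_neg_eq]
  · exact integrableOn_Ioi_rpow_of_lt (by linarith) hy
  · filter_upwards [ae_restrict_mem measurableSet_Ioi] with t ht
    exact Real.rpow_nonneg (hy.trans ht).le _

theorem markov_en (q t : ℝ) (hq : 0 < q) (ht : 0 < t) (g : ℤ → ℂ) :
    Measure.count {m : ℤ | t ≤ ‖g m‖} ≤ ENNReal.ofReal (t ^ (-q)) * en q g := by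
  have h := mul_meas_ge_le_lintegral (μ := (Measure.count : Measure ℤ))
    (f := fun m => ENNReal.ofReal (‖g m‖ ^ q)) Measurable.of_discrete (ENNReal.ofReal (t ^ q))
  rw [lintegral_count] at h
  have hs : {m : ℤ | t ≤ ‖g m‖} ⊆ {m | ENNReal.ofReal (t ^ q) ≤ ENNReal.ofReal (‖g m‖ ^ q)} := by
    intro m hm
    exact ENNReal.ofReal_le_ofReal (Real.rpow_le_rpow ht.le hm hq.le)
  have e : ENNReal.ofReal (t ^ (-q)) * ENNReal.ofReal (t ^ q) = 1 := by
    rw [← ENNReal.ofReal_mul (by positivity), ← Real.rpow_add ht]; simp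
  calc Measure.count {m : ℤ | t ≤ ‖g m‖}
      ≤ Measure.count {m : ℤ | ENNReal.ofReal (t ^ q) ≤ ENNReal.ofReal (‖g m‖ ^ q)} :=
        measure_mono hs
    _ = ENNReal.ofReal (t ^ (-q)) * (ENNReal.ofReal (t ^ q) * Measure.count
        {m : ℤ | ENNReal.ofReal (t ^ q) ≤ ENNReal.ofReal (‖g m‖ ^ q)}) := by
        rw [← mul_assoc, e, one_mul]
    _ ≤ _ := by gcongr; exact h

theorem marc (K : (ℤ → ℂ) → ℤ → ℂ) (hK : ∀ f g, K (f + g) = K f + K g)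
    (p₀ p p₁ : ℝ) (hp₀ : 0 < p₀) (h₀ : p₀ < p) (h₁ : p < p₁) (a₀ a₁ : ℝ≥0∞)
    (H₀ : ∀ f, en p₀ (K f) ≤ a₀ * en p₀ f) (H₁ : ∀ f, en p₁ (K f) ≤ a₁ * en p₁ f)
    (τ : ℝ) (hτ : 0 < τ) (f : ℤ → ℂ) :
    en p (K f) ≤ ENNReal.ofReal p *
      (a₀ * ENNReal.ofReal (2 ^ p₀ * τ ^ (p₀ - p) / (p - p₀)) +
       a₁ * ENNReal.ofReal (2 ^ p₁ * τ ^ (p₁ - p) / (p₁ - p))) * en p f := by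
  have hp : 0 < p := hp₀.trans h₀
  have hp₁ : 0 < p₁ := hp.trans h₁
  have hL := lintegral_rpow_eq_lintegral_meas_lt_mul (Measure.count : Measure ℤ)
    (f := fun m => ‖K f m‖) (Filter.Eventually.of_forall fun m => norm_nonneg _)
    (Measurable.of_discrete.aemeasurable) hp
  rw [lintegral_count] at hL
  have hL' : en p (K f) = _ := hL
  rw [hL', mul_assoc]
  gcongr
  classical
  have key : ∀ t ∈ Set.Ioi (0 : ℝ), Measure.count {m : ℤ | t < ‖K f m‖} * ENNReal.ofReal (t ^ (p - 1))
      ≤ ∑' m, (a₀ * ENNReal.ofReal (2 ^ p₀ * ‖f m‖ ^ p₀) *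
            (if τ * t < ‖f m‖ then ENNReal.ofReal (t ^ (p - p₀ - 1)) else 0) +
          a₁ * ENNReal.ofReal (2 ^ p₁ * ‖f m‖ ^ p₁) *
            (if τ * t < ‖f m‖ then 0 else ENNReal.ofReal (t ^ (-(p₁ - p) - 1)))) := by
    intro t ht
    have ht : 0 < t := ht
    set fb : ℤ → ℂ := fun m => if τ * t < ‖f m‖ then f m else 0 with hfb
    set fs : ℤ → ℂ := fun m => if τ * t < ‖f m‖ then 0 else f m with hfs
    have hsum : fb + fs = f := by
      ext m; simp only [hfb, hfs, Pi.add_apply]; split_ifs <;> simp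
    have hsub : {m : ℤ | t < ‖K f m‖} ⊆ {m | t / 2 ≤ ‖K fb m‖} ∪ {m | t / 2 ≤ ‖K fs m‖} := by
      intro m hm
      by_contra hc
      simp only [Set.mem_union, Set.mem_ofPred_eq, not_or, not_le] at hc hm
      rw [← hsum, hK] at hm
      have := norm_add_le (K fb m) (K fs m)
      simp only [Pi.add_apply] at hm
      linarith
    have ht2 : 0 < t / 2 := by linarith
    have e0 : ∀ q : ℝ, ENNReal.ofReal ((t / 2) ^ (-q)) * ENNReal.ofReal (t ^ (p - 1))
        = ENNReal.ofReal (2 ^ q) * ENNReal.ofReal (t ^ (p - q - 1)) := by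
      intro q
      rw [← ENNReal.ofReal_mul (by positivity), ← ENNReal.ofReal_mul (by positivity)]
      congr 1
      rw [Real.div_rpow ht.le (by norm_num), Real.rpow_neg (by norm_num : (0:ℝ) ≤ 2), div_inv_eq_mul,
        show p - q - 1 = -q + (p - 1) by ring, Real.rpow_add ht]
      ring
    calc Measure.count {m : ℤ | t < ‖K f m‖} * ENNReal.ofReal (t ^ (p - 1))
        ≤ (ENNReal.ofReal ((t / 2) ^ (-p₀)) * (a₀ * en p₀ fb) +
            ENNReal.ofReal ((t / 2) ^ (-p₁)) * (a₁ * en p₁ fs)) * ENNReal.ofReal (t ^ (p - 1)) := by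
          gcongr
          refine (measure_mono hsub).trans ((measure_union_le _ _).trans ?_)
          gcongr
          · exact (markov_en p₀ _ hp₀ ht2 _).trans (by gcongr; exact H₀ _)
          · exact (markov_en p₁ _ hp₁ ht2 _).trans (by gcongr; exact H₁ _)
      _ = a₀ * (ENNReal.ofReal (2 ^ p₀) * ENNReal.ofReal (t ^ (p - p₀ - 1))) * en p₀ fb +
          a₁ * (ENNReal.ofReal (2 ^ p₁) * ENNReal.ofReal (t ^ (p - p₁ - 1))) * en p₁ fs := by
          rw [← e0, ← e0]; ring
      _ = _ := by
          unfold en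
          rw [← ENNReal.tsum_mul_left, ← ENNReal.tsum_mul_left, ← ENNReal.tsum_add]
          refine tsum_congr fun m => ?_
          rw [ENNReal.ofReal_mul (by positivity), ENNReal.ofReal_mul (by positivity),
            show -(p₁ - p) - 1 = p - p₁ - 1 by ring]
          simp only [hfb, hfs]
          split_ifs
          · simp [Real.zero_rpow hp₁.ne']; ring
          · simp [Real.zero_rpow hp₀.ne']; ring
  refine (setLIntegral_mono' measurableSet_Ioi key).trans ?_
  have hm0 : ∀ c r : ℝ, Measurable fun t : ℝ =>
      (if τ * t < c then ENNReal.ofReal (t ^ r) else 0) := fun c r => by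
    refine Measurable.ite ?_ ?_ measurable_const
    · exact measurableSet_lt (by fun_prop) measurable_const
    · fun_prop
  have hm1 : ∀ c r : ℝ, Measurable fun t : ℝ =>
      (if τ * t < c then 0 else ENNReal.ofReal (t ^ r)) := fun c r => by
    refine Measurable.ite ?_ measurable_const ?_
    · exact measurableSet_lt (by fun_prop) measurable_const
    · fun_prop
  rw [lintegral_tsum]
  swap
  · exact fun m => (((hm0 _ _).const_mul _).add ((hm1 _ _).const_mul _)).aemeasurable
  unfold en
  rw [← ENNReal.tsum_mul_left]
  refine ENNReal.tsum_le_tsum fun m => ?_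
  rw [lintegral_add_left ((hm0 _ _).const_mul _), lintegral_const_mul _ (hm0 _ _),
    lintegral_const_mul _ (hm1 _ _), add_mul]
  rcases (norm_nonneg (f m)).eq_or_lt with hx | hx
  · rw [← hx]
    simp [Real.zero_rpow hp₁.ne', Real.zero_rpow hp₀.ne']
  · refine add_le_add ?_ ?_
    · refine (mul_le_mul_right (inner_big (p - p₀) τ _ (by linarith) hτ hx.le) _).trans (le_of_eq ?_)
      rw [mul_assoc, mul_assoc, ← ENNReal.ofReal_mul (by positivity),
        ← ENNReal.ofReal_mul (by have : 0 < p - p₀ := by linarith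
                                 positivity)]
      congr 2
      have e1 : (‖f m‖ / τ) ^ (p - p₀) = ‖f m‖ ^ p / ‖f m‖ ^ p₀ * τ ^ (p₀ - p) := by
        rw [Real.div_rpow hx.le hτ.le, Real.rpow_sub hx, show p₀ - p = -(p - p₀) by ring,
          Real.rpow_neg hτ.le (p - p₀)]; rfl
      rw [e1]
      field_simp
    · refine (mul_le_mul_right (inner_small (p₁ - p) τ _ (by linarith) hτ hx) _).trans (le_of_eq ?_)
      rw [mul_assoc, mul_assoc, ← ENNReal.ofReal_mul (by positivity),
        ← ENNReal.ofReal_mul (by have : 0 < p₁ - p := by linarith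
                                 positivity)]
      congr 2
      have e1 : (‖f m‖ / τ) ^ (-(p₁ - p)) = ‖f m‖ ^ p / ‖f m‖ ^ p₁ * τ ^ (p₁ - p) := by
        rw [Real.div_rpow hx.le hτ.le, show -(p₁ - p) = p - p₁ by ring, Real.rpow_sub hx,
          show p₁ - p = -(p - p₁) by ring,
          Real.rpow_neg hτ.le (p - p₁)]; rfl
      rw [e1]
      field_simp

/-! ### Part 3b: polynomials of the shift as convolution operators -/

/-- evaluation at an integer point. -/
noncomputable def evZ (P : ℝ≥0∞) (m : ℤ) : Lp ℂ P (Measure.count : Measure ℤ) →ₗ[ℂ] ℂ where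
  toFun f := f m
  map_add' f g := by
    have := Measure.ae_count_iff.1 (Lp.coeFn_add f g) m
    simpa using this
  map_smul' c f := by
    have := Measure.ae_count_iff.1 (Lp.coeFn_smul c f) m
    simpa using this

theorem evZ_apply (P : ℝ≥0∞) (m : ℤ) (f : Lp ℂ P (Measure.count : Measure ℤ)) :
    evZ P m f = f m := rfl

theorem shiftOp_apply (P : ℝ≥0∞) [Fact (1 ≤ P)] (f : Lp ℂ P (Measure.count : Measure ℤ)) (m : ℤ) :
    (shiftOp P f) m = f (m - 1) :=
  Measure.ae_count_iff.1 (Lp.coeFn_compMeasurePreserving f shift_measurePreserving) m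

theorem shiftOp_pow_apply (P : ℝ≥0∞) [Fact (1 ≤ P)] (j : ℕ)
    (f : Lp ℂ P (Measure.count : Measure ℤ)) (m : ℤ) :
    ((shiftOp P ^ j) f) m = f (m - j) := by
  induction j generalizing m with
  | zero => simp
  | succ j ih =>
    rw [pow_succ', ContinuousLinearMap.mul_apply, shiftOp_apply, ih]
    congr 1; push_cast; ring

/-- convolution with the coefficients of a polynomial. -/
noncomputable def cnv (φ : Polynomial ℂ) (f : ℤ → ℂ) (m : ℤ) : ℂ :=
  ∑ j ∈ Finset.range (φ.natDegree + 1), φ.coeff j * f (m - j)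

theorem cnv_add (φ : Polynomial ℂ) (f g : ℤ → ℂ) : cnv φ (f + g) = cnv φ f + cnv φ g := by
  ext m
  simp only [cnv, Pi.add_apply, mul_add, Finset.sum_add_distrib]

theorem aeval_shift_apply (P : ℝ≥0∞) [Fact (1 ≤ P)] (φ : Polynomial ℂ)
    (f : Lp ℂ P (Measure.count : Measure ℤ)) (m : ℤ) :
    (aeval (shiftOp P) φ f) m = cnv φ f m := by
  rw [aeval_eq_sum_range, ContinuousLinearMap.sum_apply, ← evZ_apply, map_sum, cnv]
  refine Finset.sum_congr rfl fun j _ => ?_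
  rw [ContinuousLinearMap.smul_apply, map_smul, evZ_apply, shiftOp_pow_apply, smul_eq_mul]

theorem eLpNorm_eq_en (q : ℝ) (hq : 1 ≤ q) (f : ℤ → ℂ) :
    eLpNorm f (ENNReal.ofReal q) Measure.count = (en q f) ^ (1 / q) := by
  have hq0 : 0 < q := by linarith
  rw [eLpNorm_eq_lintegral_rpow_enorm_toReal (by simpa using hq0) ENNReal.ofReal_ne_top,
    ENNReal.toReal_ofReal hq0.le, lintegral_count]
  congr 1
  refine tsum_congr fun m => ?_
  rw [← ofReal_norm_eq_enorm, ENNReal.ofReal_rpow_of_nonneg (norm_nonneg _) hq0.le]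

theorem en_eq_norm (q : ℝ) (hq : 1 ≤ q) (f : Lp ℂ (ENNReal.ofReal q) (Measure.count : Measure ℤ)) :
    en q f = ENNReal.ofReal (‖f‖ ^ q) := by
  have hq0 : 0 < q := by linarith
  rw [← ENNReal.ofReal_rpow_of_nonneg (show 0 ≤ ‖f‖ from ENNReal.toReal_nonneg) hq0.le, Lp.norm_def,
    ENNReal.ofReal_toReal (Lp.eLpNorm_ne_top f), eLpNorm_eq_en q hq, ← ENNReal.rpow_mul]
  field_simp
  simp

theorem en_cnv_le (q : ℝ) (hq : 1 ≤ q) (Q : ℝ≥0∞) [hQ1 : Fact (1 ≤ Q)] (hQ : Q = ENNReal.ofReal q)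
    (φ : Polynomial ℂ) (B : ℝ) (hB : 0 < B) (h : ‖aeval (shiftOp Q) φ‖ ≤ B) (f : ℤ → ℂ) :
    en q (cnv φ f) ≤ ENNReal.ofReal (B ^ q) * en q f := by
  subst hQ
  have hq0 : 0 < q := by linarith
  by_cases ht : en q f = ⊤
  · rw [ht, ENNReal.mul_top]
    · exact le_top
    · simpa using Real.rpow_pos_of_pos hB q
  have hm : MemLp f (ENNReal.ofReal q) (Measure.count : Measure ℤ) := by
    refine ⟨Measurable.of_discrete.aestronglyMeasurable, ?_⟩
    rw [eLpNorm_eq_en q hq]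
    exact ENNReal.rpow_lt_top_of_nonneg (by positivity) ht
  have e1 : ((hm.toLp f : Lp ℂ (ENNReal.ofReal q) (Measure.count : Measure ℤ)) : ℤ → ℂ) = f := by
    ext m; exact Measure.ae_count_iff.1 hm.coeFn_toLp m
  set F := hm.toLp f with hF
  have e2 : ((aeval (shiftOp (ENNReal.ofReal q)) φ F : Lp ℂ (ENNReal.ofReal q)
      (Measure.count : Measure ℤ)) : ℤ → ℂ) = cnv φ f := by
    ext m; rw [aeval_shift_apply, e1]
  rw [← e2]
  conv_rhs => rw [← e1]
  rw [en_eq_norm q hq, en_eq_norm q hq, ← ENNReal.ofReal_mul (by positivity),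
    ← Real.mul_rpow hB.le (norm_nonneg _)]
  refine ENNReal.ofReal_le_ofReal (Real.rpow_le_rpow (norm_nonneg _) ?_ hq0.le)
  exact (ContinuousLinearMap.le_opNorm _ _).trans (by gcongr)

theorem norm_le_of_en (q : ℝ) (hq : 1 ≤ q) [hQ1 : Fact (1 ≤ ENNReal.ofReal q)]
    (φ : Polynomial ℂ) (D : ℝ) (hD : 0 ≤ D)
    (h : ∀ f, en q (cnv φ f) ≤ ENNReal.ofReal D * en q f) :
    ‖aeval (shiftOp (ENNReal.ofReal q)) φ‖ ≤ D ^ (1 / q) := by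
  have hq0 : 0 < q := by linarith
  refine ContinuousLinearMap.opNorm_le_bound _ (by positivity) fun F => ?_
  have e2 : ((aeval (shiftOp (ENNReal.ofReal q)) φ F : Lp ℂ (ENNReal.ofReal q)
      (Measure.count : Measure ℤ)) : ℤ → ℂ) = cnv φ F := by
    ext m; rw [aeval_shift_apply]
  have := h F
  rw [← e2, en_eq_norm q hq, en_eq_norm q hq, ← ENNReal.ofReal_mul hD,
    ENNReal.ofReal_le_ofReal_iff (by positivity)] at this
  have h2 := Real.rpow_le_rpow (by positivity) this (by positivity : 0 ≤ 1 / q)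
  rw [Real.mul_rpow hD (by positivity), ← Real.rpow_mul (norm_nonneg _),
    ← Real.rpow_mul (norm_nonneg _), mul_one_div_cancel hq0.ne', Real.rpow_one, Real.rpow_one] at h2
  exact h2

theorem shiftOp_norm_le (P : ℝ≥0∞) [Fact (1 ≤ P)] : ‖shiftOp P‖ ≤ 1 :=
  LinearIsometry.norm_toContinuousLinearMap_le _

theorem nontriv_Lp (P : ℝ≥0∞) [Fact (1 ≤ P)] :
    Nontrivial (Lp ℂ P (Measure.count : Measure ℤ)) := by
  have hm : MemLp (Set.indicator {(0:ℤ)} (fun _ => (1 : ℂ))) P (Measure.count : Measure ℤ) :=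
    memLp_indicator_const P (by simp) 1 (Or.inr (by simp))
  refine ⟨hm.toLp _, 0, fun h => ?_⟩
  have e1 := Measure.ae_count_iff.1 hm.coeFn_toLp 0
  have e2 := Measure.ae_count_iff.1 (Lp.coeFn_zero ℂ P (Measure.count : Measure ℤ)) 0
  rw [h, e2] at e1
  simp at e1

theorem shift_testP_trivial (P : ℝ≥0∞) [Fact (1 ≤ P)] (N : ℕ) :
    ‖aeval (shiftOp P) (testP N)‖ ≤ 2 * N := by
  haveI := nontriv_Lp P
  exact testP_norm_le _ (shiftOp_norm_le P) N

theorem shift_two_norm (φ : Polynomial ℂ) (B : ℝ) (hB : 0 ≤ B)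
    (h : ∀ z : ℂ, ‖z‖ ≤ 1 → ‖φ.eval z‖ ≤ B) : ‖aeval (shiftOp 2) φ‖ ≤ B := by
  haveI := nontriv_Lp 2
  have hsurj : Function.Surjective (shiftOp 2) := by
    intro g
    have hmp : MeasurePreserving (fun k : ℤ => k + 1) Measure.count Measure.count := by
      have e := (MeasurableEquiv.subRight (1:ℤ))
      have := shift_measurePreserving
      have h2 : MeasurePreserving (MeasurableEquiv.subRight (1:ℤ)) Measure.count Measure.count := this
      exact h2.symm
    refine ⟨Lp.compMeasurePreserving _ hmp g, ?_⟩
    apply Lp.ext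
    refine Filter.Eventually.of_forall fun m => ?_
    rw [shiftOp_apply, Measure.ae_count_iff.1 (Lp.coeFn_compMeasurePreserving g hmp) (m - 1)]
    simp
  have hu : shiftOp 2 ∈ unitary (Lp ℂ 2 (Measure.count : Measure ℤ) →L[ℂ]
      Lp ℂ 2 (Measure.count : Measure ℤ)) := by
    have h1 : star (shiftOp 2) * shiftOp 2 = 1 := by
      rw [ContinuousLinearMap.star_eq_adjoint]
      exact (ContinuousLinearMap.norm_map_iff_adjoint_comp_self (shiftOp 2)).1
        (fun x => (Lp.compMeasurePreservingₗᵢ ℂ _ shift_measurePreserving).norm_map x)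
    refine Unitary.mem_iff.2 ⟨h1, ?_⟩
    ext1 g
    obtain ⟨f, rfl⟩ := hsurj g
    have h2 := congrArg (fun R => R f) h1
    exact congrArg (shiftOp 2) h2
  haveI hn0 : IsStarNormal (shiftOp 2) := ⟨by
    have := Unitary.mem_iff.1 hu
    rw [Commute, SemiconjBy, this.1, this.2]⟩
  haveI hn : IsStarNormal (aeval (shiftOp 2) φ) := by
    have c1 : ∀ (R Q : Lp ℂ 2 (Measure.count : Measure ℤ) →L[ℂ]
      Lp ℂ 2 (Measure.count : Measure ℤ)) , Commute R Q → Commute R (aeval Q φ) := by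
      intro R Q hc
      rw [aeval_eq_sum_range]
      exact Commute.sum_right _ _ _ fun i _ => (hc.pow_right i).smul_right _
    refine ⟨?_⟩
    refine c1 _ _ ?_
    have := c1 _ _ hn0.star_comm_self
    have h3 := this.star_star
    rw [star_star] at h3
    exact h3.symm
  have h1 := IsStarNormal.spectralRadius_eq_nnnorm (aeval (shiftOp 2) φ)
  have h2 : spectralRadius ℂ (aeval (shiftOp 2) φ) ≤ ENNReal.ofReal B := by
    unfold spectralRadius
    refine iSup₂_le fun z hz => ?_
    rw [spectrum.map_polynomial_aeval] at hz
    obtain ⟨w, hw, rfl⟩ := hz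
    have hw1 := spectrum.subset_circle_of_unitary hu hw
    rw [← enorm_eq_nnnorm, ← ofReal_norm_eq_enorm]
    exact ENNReal.ofReal_le_ofReal (h w (by simpa using (mem_sphere_zero_iff_norm.1 hw1).le))
  rw [h1, ← enorm_eq_nnnorm, ← ofReal_norm_eq_enorm, ENNReal.ofReal_le_ofReal_iff hB] at h2
  exact h2

/-! ### Part 3c: norm of the test polynomials of the shift -/

theorem en_testP_two (N : ℕ) (f : ℤ → ℂ) :
    en 2 (cnv (testP N) f) ≤ ENNReal.ofReal ((512 : ℝ) ^ (2 : ℝ)) * en 2 f := by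
  refine en_cnv_le 2 (by norm_num) 2 (by simp) _ 512 (by norm_num) ?_ f
  exact shift_two_norm _ _ (by norm_num) fun z hz => testP_disc N z hz

theorem en_testP_triv (q : ℝ) (hq : 1 ≤ q) (N : ℕ) (hN : 1 ≤ N) (f : ℤ → ℂ) :
    en q (cnv (testP N) f) ≤ ENNReal.ofReal ((2 * N : ℝ) ^ q) * en q f := by
  haveI : Fact (1 ≤ ENNReal.ofReal q) :=
    ⟨by rw [← ENNReal.ofReal_one]; exact ENNReal.ofReal_le_ofReal hq⟩
  have : (1:ℝ) ≤ N := by exact_mod_cast hN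
  exact en_cnv_le q hq _ rfl _ (2 * N) (by linarith) (shift_testP_trivial _ N) f

theorem marc_norm (p p₀ p₁ : ℝ) (hp₀ : 0 < p₀) (h0 : p₀ < p) (h1 : p < p₁) (hp : 1 ≤ p)
    [Fact (1 ≤ ENNReal.ofReal p)] (φ : Polynomial ℂ) (b₀ b₁ τ : ℝ) (hb₀ : 0 ≤ b₀) (hb₁ : 0 ≤ b₁)
    (hτ : 0 < τ)
    (H₀ : ∀ f, en p₀ (cnv φ f) ≤ ENNReal.ofReal b₀ * en p₀ f)
    (H₁ : ∀ f, en p₁ (cnv φ f) ≤ ENNReal.ofReal b₁ * en p₁ f) :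
    ‖aeval (shiftOp (ENNReal.ofReal p)) φ‖ ≤
      (p * (b₀ * (2 ^ p₀ * τ ^ (p₀ - p) / (p - p₀)) + b₁ * (2 ^ p₁ * τ ^ (p₁ - p) / (p₁ - p)))) ^ (1 / p) := by
  have i0 : 0 < p - p₀ := by linarith
  have i1 : 0 < p₁ - p := by linarith
  refine norm_le_of_en p hp φ _ (by positivity) fun f => ?_
  rw [ENNReal.ofReal_mul (by positivity), ENNReal.ofReal_add (by positivity) (by positivity),
    ENNReal.ofReal_mul hb₀, ENNReal.ofReal_mul hb₁]
  exact marc (cnv φ) (cnv_add φ) _ _ _ hp₀ h0 h1 _ _ H₀ H₁ _ hτ f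

theorem shift_testP_norm (p : ℝ) (hp : 1 < p) [Fact (1 ≤ ENNReal.ofReal p)] :
    ∃ θ C : ℝ, 0 ≤ θ ∧ θ < 1 ∧ 0 < C ∧ ∀ N : ℕ, 1 ≤ N →
      ‖aeval (shiftOp (ENNReal.ofReal p)) (testP N)‖ ≤ C * (N : ℝ) ^ θ := by
  have hp0 : 0 < p := by linarith
  rcases lt_trichotomy p 2 with h | h | h
  · -- exponents 1 and 2
    refine ⟨(2 - p) / p, (p * (2 / (p - 1) + 512 ^ (2:ℝ) * (2 ^ (2:ℝ) / (2 - p))) * 2 ^ (2 - p)) ^ (1 / p),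
      div_nonneg (by linarith) hp0.le, by rw [div_lt_one hp0]; linarith, ?_, fun N hN => ?_⟩
    · have i0 : 0 < p - 1 := by linarith
      have i1 : 0 < 2 - p := by linarith
      positivity
    have i0 : 0 < p - 1 := by linarith
    have i1 : 0 < 2 - p := by linarith
    have hN' : (0:ℝ) < N := by exact_mod_cast hN
    have hB : (0:ℝ) < 2 * N := by positivity
    refine (marc_norm p 1 2 one_pos hp h hp.le (testP N) ((2 * N : ℝ) ^ (1:ℝ)) (512 ^ (2:ℝ)) (2 * N)
      (by positivity) (by positivity) hB (en_testP_triv 1 le_rfl N hN) (en_testP_two N)).trans (le_of_eq ?_)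
    rw [div_eq_mul_one_div (2 - p) p, Real.rpow_mul hN'.le, ← Real.mul_rpow (by positivity) (by positivity)]
    congr 1
    have e : (2 * N : ℝ) ^ (1:ℝ) * (2 * N : ℝ) ^ (1 - p) = (2 * N : ℝ) ^ (2 - p) := by
      rw [← Real.rpow_add hB]; congr 1; ring
    have e2 : (2 * N : ℝ) ^ (2 - p) = 2 ^ (2 - p) * (N : ℝ) ^ (2 - p) :=
      Real.mul_rpow (by norm_num) hN'.le
    calc _ = p * (((2 * N : ℝ) ^ (1:ℝ) * (2 * N : ℝ) ^ (1 - p)) * (2 ^ (1:ℝ) / (p - 1)) +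
          512 ^ (2:ℝ) * (2 ^ (2:ℝ) / (2 - p)) * (2 * N : ℝ) ^ (2 - p)) := by ring
      _ = _ := by rw [e, e2, Real.rpow_one]; ring
  · subst h
    refine ⟨0, (512 ^ (2:ℝ)) ^ (1 / (2:ℝ)), le_rfl, one_pos, by positivity, fun N _ => ?_⟩
    rw [Real.rpow_zero, mul_one]
    exact norm_le_of_en 2 (by norm_num) _ _ (by positivity) (en_testP_two N)
  · have i0 : 0 < p - 2 := by linarith
    have i1 : 0 < p + 1 - p := by linarith
    have i2 : 0 < p - 1 := by linarith
    refine ⟨(p + 1) * (p - 2) / (p - 1) / p,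
      (p * (512 ^ (2:ℝ) * (2 ^ (2:ℝ) / (p - 2)) + 2 ^ (p + 1) / (p + 1 - p)) *
        2 ^ ((p + 1) * (p - 2) / (p - 1))) ^ (1 / p),
      by positivity, ?_, by positivity, fun N hN => ?_⟩
    · rw [div_lt_one hp0, div_lt_iff₀ i2]; nlinarith
    have hN' : (0:ℝ) < N := by exact_mod_cast hN
    have hB : (0:ℝ) < 2 * N := by positivity
    refine (marc_norm p 2 (p + 1) two_pos h (by linarith) hp.le (testP N) (512 ^ (2:ℝ))
      ((2 * N : ℝ) ^ (p + 1)) ((2 * N : ℝ) ^ (-(p + 1) / (p - 1)))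
      (by positivity) (by positivity) (by positivity) (en_testP_two N)
      (en_testP_triv (p + 1) (by linarith) N hN)).trans (le_of_eq ?_)
    rw [div_eq_mul_one_div ((p + 1) * (p - 2) / (p - 1)) p, Real.rpow_mul hN'.le, ← Real.mul_rpow (by positivity) (by positivity)]
    congr 1
    set E := (p + 1) * (p - 2) / (p - 1) with hE
    have e0 : ((2 * N : ℝ) ^ (-(p + 1) / (p - 1))) ^ (2 - p) = (2 * N : ℝ) ^ E := by
      rw [← Real.rpow_mul hB.le]; congr 1; rw [hE]; field_simp; ring
    have e1 : (2 * N : ℝ) ^ (p + 1) * ((2 * N : ℝ) ^ (-(p + 1) / (p - 1))) ^ (p + 1 - p) =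
        (2 * N : ℝ) ^ E := by
      rw [← Real.rpow_mul hB.le, ← Real.rpow_add hB]; congr 1; rw [hE]; field_simp; ring
    have e2 : (2 * N : ℝ) ^ E = 2 ^ E * (N : ℝ) ^ E :=
      Real.mul_rpow (by norm_num) hN'.le
    calc _ = p * (512 ^ (2:ℝ) * (2 ^ (2:ℝ) / (p - 2)) * ((2 * N : ℝ) ^ (-(p + 1) / (p - 1))) ^ (2 - p) +
          ((2 * N : ℝ) ^ (p + 1) * ((2 * N : ℝ) ^ (-(p + 1) / (p - 1))) ^ (p + 1 - p)) *
           (2 ^ (p + 1) / (p + 1 - p))) := by ring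
      _ = _ := by rw [e1, e0, e2]; ring

/-! ### Part 4a: the scalar sequences -/

noncomputable def aS (s : ℝ) (k : ℕ) : ℝ := ∏ i ∈ Finset.range k, (1 + s / (i + 1))

noncomputable def bS (s : ℝ) (k : ℕ) : ℝ := ∏ i ∈ Finset.range k, (1 - s / (i + 1))

noncomputable def dS (s : ℝ) : ℕ → ℝ
  | 0 => 1
  | k + 1 => s / (k + 1) * aS s k

noncomputable def cS (s : ℝ) : ℕ → ℝ
  | 0 => 1
  | k + 1 => - (s / (k + 1)) * bS s k

theorem aS_succ (s : ℝ) (k : ℕ) : aS s (k + 1) = aS s k * (1 + s / (k + 1)) := by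
  simp [aS, Finset.prod_range_succ]

theorem bS_succ (s : ℝ) (k : ℕ) : bS s (k + 1) = bS s k * (1 - s / (k + 1)) := by
  simp [bS, Finset.prod_range_succ]

theorem sum_dS (s : ℝ) (k : ℕ) : ∑ i ∈ Finset.range (k + 1), dS s i = aS s k := by
  induction k with
  | zero => simp [dS, aS]
  | succ k ih => rw [Finset.sum_range_succ, ih, aS_succ]; simp only [dS]; ring

theorem conv_partial (s : ℝ) (v : ℕ) : ∀ u : ℕ,
    ∑ k ∈ Finset.range (v + 1), dS s k * cS s (v + u + 1 - k) =
      - (s / (v + u + 1)) * aS s v * bS s u := by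
  induction v with
  | zero => intro u; simp [dS, cS, aS]
  | succ v ih =>
    intro u
    have h := ih (u + 1)
    rw [Finset.sum_range_succ, show v + 1 + u + 1 = v + (u + 1) + 1 by ring, h,
      show v + (u + 1) + 1 - (v + 1) = u + 1 by omega, aS_succ, bS_succ]
    simp only [dS, cS]
    push_cast
    have h1 : (v : ℝ) + 1 ≠ 0 := by positivity
    have h2 : (u : ℝ) + 1 ≠ 0 := by positivity
    have h3 : (v : ℝ) + (u + 1) + 1 ≠ 0 := by positivity
    have h4 : (v : ℝ) + 1 + u + 1 ≠ 0 := by positivity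
    field_simp
    ring

theorem conv_full (s : ℝ) (m : ℕ) :
    ∑ k ∈ Finset.range (m + 2), dS s k * cS s (m + 1 - k) = 0 := by
  rw [Finset.sum_range_succ]
  have := conv_partial s m 0
  simp only [add_zero] at this
  rw [this]
  simp [dS, cS, bS]

theorem bern_up {x : ℝ} (s : ℝ) (hs0 : 0 ≤ s) (hs1 : s ≤ 1) (hx : 0 < x) :
    (x + 1) ^ s ≤ x ^ s * (1 + s / x) := by
  have := rpow_one_add_le_one_add_mul_self (s := 1 / x) (by have := one_div_pos.2 hx; linarith) hs0 hs1
  calc (x + 1) ^ s = x ^ s * (1 + 1 / x) ^ s := by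
        rw [← Real.mul_rpow hx.le (by positivity)]; congr 1; field_simp
    _ ≤ x ^ s * (1 + s / x) := by
        gcongr; rw [div_eq_mul_one_div s x]; exact this

/-- `(1 - 1/x)^s ≤ 1 - s/x` -/
theorem bern_dn {x : ℝ} (s : ℝ) (hs0 : 0 ≤ s) (hs1 : s ≤ 1) (hx : 1 ≤ x) :
    (x - 1) ^ s ≤ x ^ s * (1 - s / x) := by
  have hx0 : 0 < x := by linarith
  have h1 : 1 / x ≤ 1 := by rw [div_le_one hx0]; exact hx
  have := rpow_one_add_le_one_add_mul_self (s := - (1 / x)) (by linarith) hs0 hs1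
  calc (x - 1) ^ s = x ^ s * (1 + -(1 / x)) ^ s := by
        rw [← Real.mul_rpow hx0.le (by linarith)]; congr 1; field_simp; ring
    _ ≤ x ^ s * (1 - s / x) := by
        gcongr
        refine this.trans (le_of_eq ?_); ring

theorem aS_ge (s : ℝ) (hs0 : 0 ≤ s) (hs1 : s ≤ 1) (k : ℕ) : ((k : ℝ) + 1) ^ s ≤ aS s k := by
  induction k with
  | zero => simp [aS]
  | succ k ih =>
    rw [aS_succ]
    push_cast
    refine (bern_up s hs0 hs1 (by positivity)).trans ?_
    gcongr

theorem aS_le (s : ℝ) (hs0 : 0 ≤ s) (hs1 : s ≤ 1) (k : ℕ) : aS s k ≤ 2 * ((k : ℝ) + 1) ^ s := by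
  suffices h : ∀ k : ℕ, aS s (k + 1) ≤ 2 * ((k : ℝ) + 1) ^ s by
    cases k with
    | zero => simp [aS]
    | succ k =>
      refine (h k).trans ?_
      push_cast
      gcongr
      linarith
  intro k
  induction k with
  | zero => simp [aS]; linarith
  | succ k ih =>
    rw [aS_succ]
    push_cast
    have h := bern_dn (x := (k:ℝ) + 1 + 1) s hs0 hs1 (by have := k.cast_nonneg (α := ℝ); linarith)
    have hx : (0:ℝ) < (k:ℝ) + 1 + 1 := by positivity
    set x := (k:ℝ) + 1 + 1 with hxd
    have e : x - 1 = k + 1 := by rw [hxd]; ring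
    rw [e] at h
    calc aS s (k + 1) * (1 + s / x) ≤ (2 * ((k : ℝ) + 1) ^ s) * (1 + s / x) := by gcongr
      _ ≤ (2 * (x ^ s * (1 - s / x))) * (1 + s / x) := by gcongr
      _ = 2 * x ^ s * (1 - (s / x) ^ 2) := by ring
      _ ≤ 2 * x ^ s * 1 := by gcongr; nlinarith [sq_nonneg (s / x)]
      _ = _ := by ring

theorem aS_nonneg (s : ℝ) (hs0 : 0 ≤ s) (k : ℕ) : 0 ≤ aS s k :=
  Finset.prod_nonneg fun i _ => by positivity

theorem bS_nonneg (s : ℝ) (hs1 : s ≤ 1) (k : ℕ) : 0 ≤ bS s k := by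
  refine Finset.prod_nonneg fun i _ => ?_
  rw [sub_nonneg, div_le_one (by positivity)]
  have := i.cast_nonneg (α := ℝ)
  linarith

theorem bS_le (s : ℝ) (hs0 : 0 ≤ s) (hs1 : s ≤ 1) (k : ℕ) : bS s k ≤ ((k : ℝ) + 1) ^ (-s) := by
  induction k with
  | zero => simp [bS]
  | succ k ih =>
    rw [bS_succ]
    push_cast
    have hx : (0:ℝ) < (k:ℝ) + 1 := by positivity
    have h := bern_up (x := (k:ℝ) + 1) s hs0 hs1 hx
    have hx1 : (1:ℝ) ≤ (k:ℝ) + 1 := by have := k.cast_nonneg (α := ℝ); linarith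
    set x := (k:ℝ) + 1 with hxd
    have hsx : s / x ≤ 1 := by rw [div_le_one hx]; linarith
    have p1 := Real.rpow_pos_of_pos hx s
    have p2 := Real.rpow_pos_of_pos (by linarith : 0 < x + 1) s
    rw [Real.rpow_neg (by linarith)] at ih ⊢
    calc bS s k * (1 - s / x) ≤ (x ^ s)⁻¹ * (1 - s / x) := by gcongr
      _ ≤ ((x + 1) ^ s)⁻¹ := by
        rw [inv_mul_le_iff₀ p1, ← div_eq_mul_inv, le_div_iff₀ p2]
        calc (1 - s / x) * (x + 1) ^ s ≤ (1 - s / x) * (x ^ s * (1 + s / x)) := by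
              gcongr
          _ = x ^ s * (1 - (s / x) ^ 2) := by ring
          _ ≤ x ^ s * 1 := by gcongr; nlinarith [sq_nonneg (s / x)]
          _ = _ := by ring

/-- telescoping bound for small exponents -/
theorem sum_small (θ : ℝ) (h0 : 0 < θ) (h1 : θ < 1) (n : ℕ) :
    ∑ v ∈ Finset.range n, ((v : ℝ) + 1) ^ (-θ) ≤ (n : ℝ) ^ (1 - θ) / (1 - θ) := by
  have hp : 0 < 1 - θ := by linarith
  induction n with
  | zero => simp [Real.zero_rpow hp.ne']
  | succ n ih =>
    rw [Finset.sum_range_succ]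
    have h := bern_dn (x := (n:ℝ) + 1) (1 - θ) hp.le (by linarith)
      (by have := n.cast_nonneg (α := ℝ); linarith)
    have hx : (0:ℝ) < (n:ℝ) + 1 := by positivity
    have e : ((n:ℝ) + 1) ^ (-θ) = ((n:ℝ) + 1) ^ (1 - θ) / ((n:ℝ) + 1) := by
      rw [show -θ = (1 - θ) - 1 by ring, Real.rpow_sub_one hx.ne']
    rw [add_sub_cancel_right] at h
    rw [le_div_iff₀ hp] at ih ⊢
    push_cast
    have e2 : ((n:ℝ) + 1) ^ (1 - θ) * (1 - (1 - θ) / ((n:ℝ) + 1)) =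
      ((n:ℝ) + 1) ^ (1 - θ) - (1 - θ) * ((n:ℝ) + 1) ^ (-θ) := by rw [e]; ring
    rw [e2] at h
    linarith

theorem sum_big (θ : ℝ) (h0 : 0 < θ) (h1 : θ < 1) (U n : ℕ) (hU : 1 ≤ U) :
    ∑ v ∈ Finset.range n, ((U : ℝ) + v + 1) ^ (-θ - 1) ≤ ((U : ℝ) ^ (-θ) - ((U:ℝ) + n) ^ (-θ)) / θ := by
  induction n with
  | zero => simp
  | succ n ih =>
    rw [Finset.sum_range_succ]
    have hU' : (1:ℝ) ≤ U := by exact_mod_cast hU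
    have hn := n.cast_nonneg (α := ℝ)
    set x := (U : ℝ) + n + 1 with hxd
    have hx : (0:ℝ) < x := by rw [hxd]; positivity
    have hx1 : (0:ℝ) < x - 1 := by rw [hxd]; linarith
    have h := bern_dn (x := x) θ h0.le h1.le (by linarith)
    have e1 : (U:ℝ) + ((n+1 : ℕ) : ℝ) = x := by rw [hxd]; push_cast; ring
    have e2 : (U:ℝ) + n = x - 1 := by rw [hxd]; ring
    rw [e1]; rw [e2] at ih
    have p1 := Real.rpow_pos_of_pos hx θ
    have p2 := Real.rpow_pos_of_pos hx1 θ
    have key : θ * x ^ (-θ - 1) ≤ (x - 1) ^ (-θ) - x ^ (-θ) := by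
      rw [Real.rpow_sub_one hx.ne', Real.rpow_neg hx.le, Real.rpow_neg hx1.le]
      have : (x ^ θ)⁻¹ * (1 + θ / x) ≤ ((x - 1) ^ θ)⁻¹ := by
        rw [inv_mul_le_iff₀ p1, ← div_eq_mul_inv, le_div_iff₀ p2]
        calc (1 + θ / x) * (x - 1) ^ θ ≤ (1 + θ / x) * (x ^ θ * (1 - θ / x)) := by gcongr
          _ = x ^ θ * (1 - (θ / x) ^ 2) := by ring
          _ ≤ x ^ θ * 1 := by gcongr; nlinarith [sq_nonneg (θ / x)]
          _ = _ := by ring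
      have e3 : (x ^ θ)⁻¹ * (1 + θ / x) = (x ^ θ)⁻¹ + θ * ((x ^ θ)⁻¹ / x) := by ring
      linarith
    rw [le_div_iff₀ h0] at ih ⊢
    linarith

/-- the discrete Hilbert type inequality -/
theorem hilb (θ : ℝ) (h0 : 0 < θ) (h1 : θ < 1) (U n : ℕ) (hU : 1 ≤ U) :
    ∑ v ∈ Finset.range n, ((v : ℝ) + 1) ^ (-θ) / ((U : ℝ) + v + 1) ≤
      (1 / (1 - θ) + 1 / θ) * (U : ℝ) ^ (-θ) := by
  have hU' : (0:ℝ) < U := by exact_mod_cast hU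
  have hp : 0 < 1 - θ := by linarith
  have hle : ∑ v ∈ Finset.range n, ((v : ℝ) + 1) ^ (-θ) / ((U : ℝ) + v + 1) ≤
      ∑ v ∈ Finset.range (U + n), ((v : ℝ) + 1) ^ (-θ) / ((U : ℝ) + v + 1) :=
    Finset.sum_le_sum_of_subset_of_nonneg (Finset.range_mono (by omega))
      fun i _ _ => by positivity
  refine hle.trans ?_
  rw [Finset.sum_range_add, add_mul]
  refine add_le_add ?_ ?_
  · calc _ ≤ ∑ v ∈ Finset.range U, ((v : ℝ) + 1) ^ (-θ) / (U : ℝ) := by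
          refine Finset.sum_le_sum fun v _ => ?_
          gcongr
          have := v.cast_nonneg (α := ℝ); linarith
      _ = (∑ v ∈ Finset.range U, ((v : ℝ) + 1) ^ (-θ)) / U := by rw [Finset.sum_div]
      _ ≤ ((U : ℝ) ^ (1 - θ) / (1 - θ)) / U := by gcongr; exact sum_small θ h0 h1 U
      _ = _ := by
          rw [show -θ = (1 - θ) - 1 by ring, Real.rpow_sub_one hU'.ne']; ring
  · calc _ ≤ ∑ v ∈ Finset.range n, ((U : ℝ) + v + 1) ^ (-θ - 1) := by
          refine Finset.sum_le_sum fun v _ => ?_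
          have hx : (0:ℝ) < (U:ℝ) + v + 1 := by positivity
          rw [Real.rpow_sub_one hx.ne']
          push_cast
          gcongr
          have := v.cast_nonneg (α := ℝ); linarith
      _ ≤ _ := sum_big θ h0 h1 U n hU
      _ ≤ _ := by
          rw [one_div, inv_mul_eq_div]
          gcongr
          have : 0 ≤ ((U:ℝ) + n) ^ (-θ) := by positivity
          linarith

theorem abs_dS_le (s : ℝ) (hs0 : 0 ≤ s) (hs1 : s ≤ 1 / 2) (k : ℕ) :
    |dS s (k + 1)| ≤ ((k : ℝ) + 1) ^ (s - 1) := by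
  have hx : (0:ℝ) < (k:ℝ) + 1 := by positivity
  have h := aS_le s hs0 (by linarith) k
  have h2 := aS_nonneg s hs0 k
  simp only [dS]
  rw [abs_of_nonneg (by positivity), Real.rpow_sub_one hx.ne', div_mul_eq_mul_div]
  gcongr
  have := Real.rpow_pos_of_pos hx s
  nlinarith

theorem abs_cS_le (s : ℝ) (hs0 : 0 ≤ s) (hs1 : s ≤ 1 / 2) (k : ℕ) :
    |cS s (k + 1)| ≤ ((k : ℝ) + 1) ^ (s - 1) := by
  have hx : (0:ℝ) < (k:ℝ) + 1 := by positivity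
  have hx1 : (1:ℝ) ≤ (k:ℝ) + 1 := by have := k.cast_nonneg (α := ℝ); linarith
  have h := bS_le s hs0 (by linarith) k
  have h2 := bS_nonneg s (by linarith) k
  simp only [cS]
  rw [neg_mul, abs_neg, abs_of_nonneg (by positivity), Real.rpow_sub_one hx.ne', div_mul_eq_mul_div]
  gcongr
  have h3 : ((k : ℝ) + 1) ^ (-s) ≤ ((k : ℝ) + 1) ^ s := Real.rpow_le_rpow_of_exponent_le hx1 (by linarith)
  have := Real.rpow_pos_of_pos hx s
  nlinarith

theorem sum_sq_le (s : ℝ) (hs0 : 0 < s) (hs1 : s < 1 / 2) (n : ℕ) (e : ℕ → ℝ) (he0 : e 0 = 1)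
    (he : ∀ k : ℕ, |e (k + 1)| ≤ ((k : ℝ) + 1) ^ (s - 1)) :
    ∑ k ∈ Finset.range n, e k ^ 2 ≤ 2 + 1 / (1 - 2 * s) := by
  have hθ : 0 < 1 - 2 * s := by linarith
  have hle : ∑ k ∈ Finset.range n, e k ^ 2 ≤ ∑ k ∈ Finset.range (n + 2), e k ^ 2 :=
    Finset.sum_le_sum_of_subset_of_nonneg (Finset.range_mono (by omega)) fun i _ _ => by positivity
  refine hle.trans ?_
  rw [Finset.sum_range_succ', Finset.sum_range_succ']
  have h1 : e (0 + 1) ^ 2 ≤ 1 := by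
    have := he 0
    simp at this
    rw [sq_le_one_iff_abs_le_one]; exact this
  have h2 : ∑ k ∈ Finset.range n, e (k + 1 + 1) ^ 2 ≤ 1 / (1 - 2 * s) := by
    calc _ ≤ ∑ v ∈ Finset.range n, (((1:ℕ) : ℝ) + v + 1) ^ (-(1 - 2 * s) - 1) := by
          refine Finset.sum_le_sum fun v _ => ?_
          have := he (v + 1)
          push_cast at this ⊢
          have hx : (0:ℝ) ≤ 1 + (v:ℝ) + 1 := by positivity
          rw [show -(1 - 2 * s) - 1 = (s - 1) * 2 by ring, Real.rpow_mul hx, ← sq_abs, Real.rpow_two,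
            add_comm 1 (v:ℝ)]
          gcongr
      _ ≤ _ := sum_big _ hθ (by linarith) 1 n le_rfl
      _ ≤ _ := by
          gcongr
          have : (0:ℝ) ≤ (((1:ℕ):ℝ) + n) ^ (-(1 - 2 * s)) := by positivity
          simp at this ⊢; exact this
  rw [he0]
  linarith

theorem sum_pow_ge (s : ℝ) (hs0 : 0 ≤ s) (hs1 : s ≤ 1 / 2) (n : ℕ) :
    (n : ℝ) ^ (1 + 2 * s) ≤ 2 * ∑ k ∈ Finset.range n, ((k : ℝ) + 1) ^ (2 * s) := by
  induction n with
  | zero => simp [Real.zero_rpow (by linarith : (1 + 2 * s) ≠ 0)]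
  | succ n ih =>
    rw [Finset.sum_range_succ, mul_add]
    have hn := n.cast_nonneg (α := ℝ)
    have hx : (0:ℝ) < (n:ℝ) + 1 := by positivity
    push_cast
    set x := (n:ℝ) + 1 with hxd
    have h1 : 1 / x ≤ 1 := by rw [div_le_one hx]; linarith
    have h := one_add_mul_self_le_rpow_one_add (s := -(1 / x)) (by linarith) (p := 1 + 2 * s) (by linarith)
    have e : (n : ℝ) ^ (1 + 2 * s) = x ^ (1 + 2 * s) * (1 + -(1 / x)) ^ (1 + 2 * s) := by
      rw [← Real.mul_rpow hx.le (by linarith)]; congr 1; field_simp; rw [hxd]; ring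
    have e2 : x ^ (1 + 2 * s) = x * x ^ (2 * s) := by
      rw [Real.rpow_add hx, Real.rpow_one]
    have p := Real.rpow_pos_of_pos hx (2 * s)
    have h3 : x ^ (1 + 2 * s) * (1 + (1 + 2 * s) * -(1 / x)) ≤ (n : ℝ) ^ (1 + 2 * s) := by
      rw [e]; gcongr
    have h4 : x ^ (1 + 2 * s) * (1 + (1 + 2 * s) * -(1 / x)) =
        x ^ (1 + 2 * s) - (1 + 2 * s) * x ^ (2 * s) := by
      rw [e2]; field_simp; ring
    rw [h4] at h3
    nlinarith

/-! ### Part 4b: entries of the partial sum projections and Schur bounds -/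

/-- entries of the partial sum projection. -/
noncomputable def qN (s : ℝ) (n i j : ℕ) : ℝ :=
  if i < n then (if i = j then 1 else 0)
  else if j < n then -(s / ((i : ℝ) - j)) * aS s (n - 1 - j) * bS s (i - n) else 0

theorem entry_sum (s : ℝ) (N n i j : ℕ) (hn : min n (i + 1) ≤ N) :
    ∑ k ∈ Finset.range N, (if k ≤ i then cS s (i - k) else 0) * (if k < n then 1 else 0) *
      (if j ≤ k then dS s (k - j) else 0) =
    ∑ t ∈ Finset.range (min n (i + 1) - j), dS s t * cS s (i - j - t) := by
  have h1 : ∑ t ∈ Finset.range (min n (i + 1) - j), dS s t * cS s (i - j - t) =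
      ∑ k ∈ Finset.Ico j (min n (i + 1)), dS s (k - j) * cS s (i - k) := by
    rw [Finset.sum_Ico_eq_sum_range]
    refine Finset.sum_congr rfl fun t ht => ?_
    rw [show j + t - j = t by omega, show i - (j + t) = i - j - t by omega]
  rw [h1]
  have hsub : Finset.Ico j (min n (i + 1)) ⊆ Finset.range N := by
    intro k hk
    rw [Finset.mem_Ico] at hk
    rw [Finset.mem_range]; omega
  rw [← Finset.sum_subset hsub]
  · refine Finset.sum_congr rfl fun k hk => ?_
    rw [Finset.mem_Ico] at hk
    rw [if_pos (by omega), if_pos (by omega), if_pos (by omega)]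
    ring
  · intro k _ hk
    rw [Finset.mem_Ico] at hk
    by_cases h1 : k ≤ i
    · by_cases h2 : k < n
      · rw [if_neg (show ¬ j ≤ k by omega)]; simp
      · simp [h2]
    · simp [h1]

theorem entry_eq (s : ℝ) (N n i j : ℕ) (hn : n ≤ N) :
    ∑ k ∈ Finset.range N, (if k ≤ i then cS s (i - k) else 0) * (if k < n then 1 else 0) *
      (if j ≤ k then dS s (k - j) else 0) = qN s n i j := by
  rw [entry_sum s N n i j (by omega)]
  unfold qN
  by_cases h1 : i < n
  · rw [if_pos h1, show min n (i + 1) = i + 1 by omega]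
    rcases lt_trichotomy i j with h | h | h
    · rw [if_neg (by omega), show i + 1 - j = 0 by omega]; simp
    · subst h; simp [dS, cS]
    · rw [if_neg (by omega)]
      obtain ⟨m, rfl⟩ : ∃ m, i = j + (m + 1) := ⟨i - j - 1, by omega⟩
      rw [show j + (m + 1) + 1 - j = m + 2 by omega, show j + (m + 1) - j = m + 1 by omega]
      exact conv_full s m
  · rw [if_neg h1, show min n (i + 1) = n by omega]
    by_cases h2 : j < n
    · rw [if_pos h2]
      obtain ⟨v, rfl⟩ : ∃ v, n = j + v + 1 := ⟨n - j - 1, by omega⟩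
      obtain ⟨u, rfl⟩ : ∃ u, i = j + v + 1 + u := ⟨i - (j + v + 1), by omega⟩
      have := conv_partial s v u
      rw [show j + v + 1 - j = v + 1 by omega, show j + v + 1 + u - j = v + u + 1 by omega, this,
        show j + v + 1 - 1 - j = v by omega, show j + v + 1 + u - (j + v + 1) = u by omega]
      push_cast
      congr 4
      ring
    · rw [if_neg h2, show n - j = 0 by omega]; simp

noncomputable def omg (n i : ℕ) : ℝ :=
  if i < n then ((n - 1 - i : ℕ) + 1 : ℝ) ^ (-(1 / 2) : ℝ) else ((i - n : ℕ) + 1 : ℝ) ^ (-(1 / 2) : ℝ)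

theorem omg_pos (n i : ℕ) : 0 < omg n i := by unfold omg; split_ifs <;> positivity

/-- the off-diagonal bound. -/
theorem qN_off (s : ℝ) (hs0 : 0 < s) (hs1 : s < 1 / 2) (n u v : ℕ) (hv : v < n) :
    |qN s n (n + u) (n - 1 - v)| ≤
      2 * ((v : ℝ) + 1) ^ s * ((u : ℝ) + 1) ^ (-s) / ((u : ℝ) + v + 2) := by
  obtain ⟨w, rfl⟩ : ∃ w, n = w + v + 1 := ⟨n - v - 1, by omega⟩
  unfold qN
  rw [if_neg (by omega), if_pos (by omega), show w + v + 1 - 1 - (w + v + 1 - 1 - v) = v by omega,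
    show w + v + 1 + u - (w + v + 1) = u by omega, show w + v + 1 - 1 - v = w by omega]
  have e : ((w + v + 1 + u : ℕ) : ℝ) - (w : ℝ) = (u : ℝ) + v + 1 := by push_cast; ring
  rw [e]
  have ha := aS_le s hs0.le (by linarith) v
  have ha0 := aS_nonneg s hs0.le v
  have hb := bS_le s hs0.le (by linarith) u
  have hb0 := bS_nonneg s (by linarith) u
  have hx : (0:ℝ) < (u : ℝ) + v + 1 := by positivity
  have hx2 : (0:ℝ) < (u : ℝ) + v + 2 := by positivity
  rw [neg_mul, neg_mul, abs_neg, abs_of_nonneg (by positivity)]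
  have h1 : s / ((u : ℝ) + v + 1) ≤ 1 / ((u : ℝ) + v + 2) := by
    rw [div_le_div_iff₀ hx hx2]
    nlinarith [u.cast_nonneg (α := ℝ), v.cast_nonneg (α := ℝ)]
  calc _ ≤ 1 / ((u : ℝ) + v + 2) * (2 * ((v : ℝ) + 1) ^ s) * ((u : ℝ) + 1) ^ (-s) := by gcongr
    _ = _ := by ring

/-- the common Schur constant. -/
noncomputable def cSch (s : ℝ) : ℝ :=
  1 + 2 * (1 / (1 - (1 / 2 - s)) + 1 / (1 / 2 - s)) + 2 * (1 / (1 - (1 / 2 + s)) + 1 / (1 / 2 + s))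

theorem schur_row (s : ℝ) (hs0 : 0 < s) (hs1 : s < 1 / 2) (n r i : ℕ) (hi : i < n + r) :
    ∑ j ∈ Finset.range (n + r), |qN s n i j| * omg n j ≤ cSch s * omg n i := by
  have p1 : 0 < 1 - (1 / 2 - s) := by linarith
  have p2 : 0 < 1 / 2 - s := by linarith
  have p3 : 0 < 1 - (1 / 2 + s) := by linarith
  have p4 : 0 < 1 / 2 + s := by linarith
  have hC : 1 ≤ cSch s := by
    unfold cSch
    have : 0 ≤ 2 * (1 / (1 - (1 / 2 - s)) + 1 / (1 / 2 - s)) := by positivity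
    have : 0 ≤ 2 * (1 / (1 - (1 / 2 + s)) + 1 / (1 / 2 + s)) := by positivity
    linarith
  by_cases h : i < n
  · have : ∑ j ∈ Finset.range (n + r), |qN s n i j| * omg n j = omg n i := by
      rw [Finset.sum_eq_single i]
      · simp [qN, h]
      · intro j _ hj; simp [qN, h, hj.symm]
      · intro h'; simp at h'; omega
    rw [this]
    nlinarith [omg_pos n i]
  · obtain ⟨u, rfl⟩ : ∃ u, i = n + u := ⟨i - n, by omega⟩
    rw [Finset.sum_range_add]
    have z : ∑ x ∈ Finset.range r, |qN s n (n + u) (n + x)| * omg n (n + x) = 0 :=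
      Finset.sum_eq_zero fun x _ => by simp [qN]
    rw [z, add_zero, ← Finset.sum_range_reflect]
    have hx : (0:ℝ) < (u:ℝ) + 1 := by positivity
    calc _ ≤ ∑ v ∈ Finset.range n, (2 * ((u : ℝ) + 1) ^ (-s)) *
            (((v : ℝ) + 1) ^ (-(1 / 2 - s)) / (((u + 1 : ℕ) : ℝ) + v + 1)) := by
          refine Finset.sum_le_sum fun v hv => ?_
          rw [Finset.mem_range] at hv
          have e : omg n (n - 1 - v) = ((v : ℝ) + 1) ^ (-(1 / 2) : ℝ) := by
            unfold omg
            rw [if_pos (by omega), show n - 1 - (n - 1 - v) = v by omega]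
          have hy : (0:ℝ) < (v:ℝ) + 1 := by positivity
          rw [e]
          refine (mul_le_mul_of_nonneg_right (qN_off s hs0 hs1 n u v hv) (by positivity)).trans (le_of_eq ?_)
          rw [show -(1 / 2 - s) = s + -(1 / 2) by ring, Real.rpow_add hy]
          push_cast
          rw [show (u:ℝ) + 1 + v + 1 = u + v + 2 by ring]
          ring
      _ ≤ (2 * ((u : ℝ) + 1) ^ (-s)) * ((1 / (1 - (1 / 2 - s)) + 1 / (1 / 2 - s)) *
            ((u + 1 : ℕ) : ℝ) ^ (-(1 / 2 - s))) := by
          rw [← Finset.mul_sum]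
          gcongr
          exact hilb _ p2 (by linarith) (u + 1) n (by omega)
      _ = 2 * (1 / (1 - (1 / 2 - s)) + 1 / (1 / 2 - s)) * omg n (n + u) := by
          unfold omg
          rw [if_neg (by omega), show n + u - n = u by omega, show (-(1/2) : ℝ) = -s + -(1 / 2 - s) by ring,
            Real.rpow_add hx]
          push_cast
          ring
      _ ≤ _ := by
          refine mul_le_mul_of_nonneg_right ?_ (omg_pos _ _).le
          unfold cSch
          have : 0 ≤ 2 * (1 / (1 - (1 / 2 + s)) + 1 / (1 / 2 + s)) := by positivity
          linarith

theorem schur_col (s : ℝ) (hs0 : 0 < s) (hs1 : s < 1 / 2) (n r j : ℕ) (hj : j < n + r) :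
    ∑ i ∈ Finset.range (n + r), |qN s n i j| * omg n i ≤ cSch s * omg n j := by
  have p1 : 0 < 1 - (1 / 2 - s) := by linarith
  have p2 : 0 < 1 / 2 - s := by linarith
  have p3 : 0 < 1 - (1 / 2 + s) := by linarith
  have p4 : 0 < 1 / 2 + s := by linarith
  have hC : 1 + 2 * (1 / (1 - (1 / 2 + s)) + 1 / (1 / 2 + s)) ≤ cSch s := by
    unfold cSch
    have : 0 ≤ 2 * (1 / (1 - (1 / 2 - s)) + 1 / (1 / 2 - s)) := by positivity
    linarith
  have hC0 : 0 ≤ cSch s := by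
    have : 0 ≤ 2 * (1 / (1 - (1 / 2 + s)) + 1 / (1 / 2 + s)) := by positivity
    linarith
  by_cases h : j < n
  · rw [Finset.sum_range_add]
    have h1 : ∑ i ∈ Finset.range n, |qN s n i j| * omg n i = omg n j := by
      rw [Finset.sum_eq_single j]
      · simp [qN, h]
      · intro i hi hj; rw [Finset.mem_range] at hi; simp [qN, hi, hj]
      · intro h'; simp at h'; omega
    rw [h1]
    obtain ⟨v, hv, rfl⟩ : ∃ v, v < n ∧ j = n - 1 - v := ⟨n - 1 - j, by omega, by omega⟩
    have hx : (0:ℝ) < (v:ℝ) + 1 := by positivity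
    have h2 : ∑ u ∈ Finset.range r, |qN s n (n + u) (n - 1 - v)| * omg n (n + u) ≤
        2 * (1 / (1 - (1 / 2 + s)) + 1 / (1 / 2 + s)) * omg n (n - 1 - v) := by
      calc _ ≤ ∑ u ∈ Finset.range r, (2 * ((v : ℝ) + 1) ^ s) *
            (((u : ℝ) + 1) ^ (-(1 / 2 + s)) / (((v + 1 : ℕ) : ℝ) + u + 1)) := by
            refine Finset.sum_le_sum fun u _ => ?_
            have e : omg n (n + u) = ((u : ℝ) + 1) ^ (-(1 / 2) : ℝ) := by
              unfold omg
              rw [if_neg (by omega), show n + u - n = u by omega]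
            have hy : (0:ℝ) < (u:ℝ) + 1 := by positivity
            rw [e]
            refine (mul_le_mul_of_nonneg_right (qN_off s hs0 hs1 n u v hv) (by positivity)).trans (le_of_eq ?_)
            rw [show -(1 / 2 + s) = -s + -(1 / 2) by ring, Real.rpow_add hy]
            push_cast
            rw [show (v:ℝ) + 1 + u + 1 = u + v + 2 by ring]
            ring
        _ ≤ (2 * ((v : ℝ) + 1) ^ s) * ((1 / (1 - (1 / 2 + s)) + 1 / (1 / 2 + s)) *
            ((v + 1 : ℕ) : ℝ) ^ (-(1 / 2 + s))) := by
            rw [← Finset.mul_sum]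
            gcongr
            exact hilb _ p4 (by linarith) (v + 1) r (by omega)
        _ = _ := by
            unfold omg
            rw [if_pos (by omega), show n - 1 - (n - 1 - v) = v by omega,
              show (-(1/2) : ℝ) = s + -(1 / 2 + s) by ring, Real.rpow_add hx]
            push_cast
            ring
    nlinarith [omg_pos n (n - 1 - v)]
  · have : ∑ i ∈ Finset.range (n + r), |qN s n i j| * omg n i = 0 := by
      refine Finset.sum_eq_zero fun i _ => ?_
      have : qN s n i j = 0 := by
        unfold qN
        by_cases hi : i < n
        · rw [if_pos hi, if_neg (by omega)]
        · rw [if_neg hi, if_neg h]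
      rw [this]; simp
    rw [this]
    exact mul_nonneg hC0 (omg_pos _ _).le

/-! ### Part 4c: matrices -/

section MatrixPart

open scoped Matrix Matrix.Norms.L2Operator

theorem schur_test {ι : Type*} [Fintype ι] [DecidableEq ι] (M : Matrix ι ι ℂ) (w : ι → ℝ)
    (hw : ∀ i, 0 < w i) (C : ℝ) (hC : 0 ≤ C)
    (hr : ∀ i, ∑ j, ‖M i j‖ * w j ≤ C * w i) (hc : ∀ j, ∑ i, ‖M i j‖ * w i ≤ C * w j) :
    ‖M‖ ≤ C := by
  rw [Matrix.cstar_norm_def]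
  refine ContinuousLinearMap.opNorm_le_bound _ hC fun x => ?_
  refine le_of_sq_le_sq ?_ (by positivity)
  rw [mul_pow, EuclideanSpace.norm_sq_eq, EuclideanSpace.norm_sq_eq]
  have h1 : ∀ i, ‖(Matrix.toEuclideanCLM (n := ι) (𝕜 := ℂ) M x) i‖ ^ 2 ≤
      C * w i * ∑ j, ‖M i j‖ * (‖x j‖ ^ 2 / w j) := by
    intro i
    rw [Matrix.ofLp_toEuclideanCLM]
    have a1 : ‖(M *ᵥ x.ofLp) i‖ ≤ ∑ j, ‖M i j‖ * ‖x j‖ := by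
      rw [Matrix.mulVec, dotProduct]
      refine (norm_sum_le _ _).trans (le_of_eq ?_)
      simp
    have a2 : (∑ j, ‖M i j‖ * ‖x j‖) ^ 2 ≤ (∑ j, ‖M i j‖ * w j) * ∑ j, ‖M i j‖ * (‖x j‖ ^ 2 / w j) := by
      refine Finset.sum_sq_le_sum_mul_sum_of_sq_le_mul _ (fun j _ => ?_) (fun j _ => ?_) fun j _ => le_of_eq ?_
      · have := hw j; positivity
      · have := hw j; positivity
      · have := (hw j).ne'; field_simp
    calc _ ≤ (∑ j, ‖M i j‖ * ‖x j‖) ^ 2 := by gcongr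
      _ ≤ _ := a2
      _ ≤ _ := by
        refine mul_le_mul_of_nonneg_right (hr i) (Finset.sum_nonneg fun j _ => ?_)
        have := hw j; positivity
  calc _ ≤ ∑ i, C * w i * ∑ j, ‖M i j‖ * (‖x j‖ ^ 2 / w j) := Finset.sum_le_sum fun i _ => h1 i
    _ = ∑ j, C * (‖x j‖ ^ 2 / w j) * ∑ i, ‖M i j‖ * w i := by
      simp_rw [Finset.mul_sum]
      rw [Finset.sum_comm]
      refine Finset.sum_congr rfl fun j _ => Finset.sum_congr rfl fun i _ => ?_
      ring
    _ ≤ ∑ j, C * (‖x j‖ ^ 2 / w j) * (C * w j) := by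
      refine Finset.sum_le_sum fun j _ => mul_le_mul_of_nonneg_left (hc j) ?_
      have := hw j; positivity
    _ = _ := by
      rw [Finset.mul_sum]
      refine Finset.sum_congr rfl fun j _ => ?_
      have := (hw j).ne'
      field_simp

theorem rank_one_norm {ι : Type*} [Fintype ι] [DecidableEq ι] (M : Matrix ι ι ℂ) (u v : ι → ℂ)
    (K : ℝ) (hM : ∀ i j, M i j = u i * v j) (hu : ∑ i, ‖u i‖ ^ 2 ≤ K) (hv : ∑ i, ‖v i‖ ^ 2 ≤ K) :
    ‖M‖ ≤ K := by
  have hK : 0 ≤ K := (Finset.sum_nonneg fun i _ => by positivity).trans hu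
  rw [Matrix.cstar_norm_def]
  refine ContinuousLinearMap.opNorm_le_bound _ hK fun x => ?_
  refine le_of_sq_le_sq ?_ (by positivity)
  rw [mul_pow, EuclideanSpace.norm_sq_eq, EuclideanSpace.norm_sq_eq]
  have h1 : ∀ i, ‖(Matrix.toEuclideanCLM (n := ι) (𝕜 := ℂ) M x) i‖ ^ 2 ≤
      ‖u i‖ ^ 2 * (K * ∑ j, ‖x j‖ ^ 2) := by
    intro i
    rw [Matrix.ofLp_toEuclideanCLM]
    have a1 : ‖(M *ᵥ x.ofLp) i‖ ≤ ‖u i‖ * ∑ j, ‖v j‖ * ‖x j‖ := by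
      rw [Matrix.mulVec, dotProduct, Finset.mul_sum]
      refine (norm_sum_le _ _).trans (le_of_eq ?_)
      simp [hM, mul_assoc]
    have a2 : (∑ j, ‖v j‖ * ‖x j‖) ^ 2 ≤ (∑ j, ‖v j‖ ^ 2) * ∑ j, ‖x j‖ ^ 2 :=
      Finset.sum_mul_sq_le_sq_mul_sq _ _ _
    calc _ ≤ (‖u i‖ * ∑ j, ‖v j‖ * ‖x j‖) ^ 2 := by gcongr
      _ = ‖u i‖ ^ 2 * (∑ j, ‖v j‖ * ‖x j‖) ^ 2 := by ring
      _ ≤ _ := by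
        gcongr
        refine a2.trans ?_
        gcongr
  calc _ ≤ ∑ i, ‖u i‖ ^ 2 * (K * ∑ j, ‖x j‖ ^ 2) := Finset.sum_le_sum fun i _ => h1 i
    _ = (∑ i, ‖u i‖ ^ 2) * (K * ∑ j, ‖x j‖ ^ 2) := by rw [Finset.sum_mul]
    _ ≤ K * (K * ∑ j, ‖x j‖ ^ 2) := by gcongr
    _ = _ := by ring

noncomputable def mC (s : ℝ) (N : ℕ) : Matrix (Fin N) (Fin N) ℂ :=
  fun i k => if (k : ℕ) ≤ i then (cS s (i - k) : ℂ) else 0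

noncomputable def mD (s : ℝ) (N : ℕ) : Matrix (Fin N) (Fin N) ℂ :=
  fun i k => if (k : ℕ) ≤ i then (dS s (i - k) : ℂ) else 0

/-- cut-off vector -/
noncomputable def cut (N n : ℕ) : Fin N → ℂ := fun i => if (i : ℕ) < n then 1 else 0

theorem mQ_entry (s : ℝ) (N n : ℕ) (hn : n ≤ N) (i j : Fin N) :
    (mC s N * Matrix.diagonal (cut N n) * mD s N) i j = (qN s n i j : ℂ) := by
  rw [← entry_eq s N n i j hn, Matrix.mul_apply]
  simp only [Matrix.mul_diagonal]
  rw [← Fin.sum_univ_eq_sum_range (fun k => (if k ≤ (i:ℕ) then cS s (i - k) else 0) *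
    (if k < n then 1 else 0) * (if (j:ℕ) ≤ k then dS s (k - j) else 0))]
  push_cast
  refine Finset.sum_congr rfl fun k _ => ?_
  simp only [mC, mD, cut]
  split_ifs <;> simp

theorem mC_mul_mD (s : ℝ) (N : ℕ) : mC s N * mD s N = 1 := by
  have h : Matrix.diagonal (cut N N) = 1 := by
    rw [← Matrix.diagonal_one]; congr 1; ext i; simp [cut]
  ext i j
  have := mQ_entry s N N le_rfl i j
  rw [h, mul_one] at this
  rw [this, qN, if_pos i.2, Matrix.one_apply]
  simp only [Fin.ext_iff]
  split_ifs <;> simp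

theorem mD_mul_mC (s : ℝ) (N : ℕ) : mD s N * mC s N = 1 :=
  mul_eq_one_comm.1 (mC_mul_mD s N)

noncomputable def mW (s : ℝ) (N : ℕ) : Matrix (Fin N ⊕ Fin N) (Fin N ⊕ Fin N) ℂ :=
  Matrix.fromBlocks (mC s N) (mC s N) (mD s N)ᵀ (-(mD s N)ᵀ)

noncomputable def mV (s : ℝ) (N : ℕ) : Matrix (Fin N ⊕ Fin N) (Fin N ⊕ Fin N) ℂ :=
  (1 / 2 : ℂ) • Matrix.fromBlocks (mD s N) (mC s N)ᵀ (mD s N) (-(mC s N)ᵀ)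

/-- the diagonal calculus -/
noncomputable def cj (s : ℝ) (N : ℕ) :
    (Fin N ⊕ Fin N → ℂ) →ₗ[ℂ] Matrix (Fin N ⊕ Fin N) (Fin N ⊕ Fin N) ℂ where
  toFun m := mW s N * Matrix.diagonal m * mV s N
  map_add' a b := by
    rw [← add_mul, ← mul_add, Matrix.diagonal_add]; rfl
  map_smul' c a := by
    rw [RingHom.id_apply, Matrix.diagonal_smul, Matrix.mul_smul, Matrix.smul_mul]

theorem cj_def (s : ℝ) (N : ℕ) (m) : cj s N m = mW s N * Matrix.diagonal m * mV s N := rfl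

theorem diag_zero' (N : ℕ) : Matrix.diagonal (0 : Fin N → ℂ) = 0 := Matrix.diagonal_zero

theorem cj_elim (s : ℝ) (N : ℕ) (a b : Fin N → ℂ) :
    cj s N (Sum.elim a b) = (1 / 2 : ℂ) • Matrix.fromBlocks
      (mC s N * Matrix.diagonal (a + b) * mD s N) (mC s N * Matrix.diagonal (a - b) * (mC s N)ᵀ)
      ((mD s N)ᵀ * Matrix.diagonal (a - b) * mD s N) ((mD s N)ᵀ * Matrix.diagonal (a + b) * (mC s N)ᵀ) := by
  have e1 : Matrix.diagonal (a + b) = Matrix.diagonal a + Matrix.diagonal b :=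
    (Matrix.diagonal_add a b).symm
  have e2 : Matrix.diagonal (a - b) = Matrix.diagonal a - Matrix.diagonal b :=
    (Matrix.diagonal_sub a b).symm
  rw [cj_def, mW, mV, Matrix.mul_smul, ← Matrix.fromBlocks_diagonal, Matrix.fromBlocks_multiply,
    Matrix.fromBlocks_multiply, e1, e2]
  congr 1
  congr 1 <;> simp only [mul_add, add_mul, mul_sub, sub_mul, sub_eq_add_neg, Matrix.mul_zero, Matrix.zero_mul, add_zero, zero_add, mul_neg, neg_mul, neg_neg, neg_zero]

theorem mV_mul_mW (s : ℝ) (N : ℕ) : mV s N * mW s N = 1 := by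
  refine mul_eq_one_comm.1 ?_
  have h := cj_elim s N 1 1
  have e : (Sum.elim 1 1 : Fin N ⊕ Fin N → ℂ) = 1 := by ext i; cases i <;> rfl
  have e0 : Matrix.diagonal ((1 : Fin N → ℂ) + 1) = (2:ℂ) • (1 : Matrix (Fin N) (Fin N) ℂ) := by
    rw [← Matrix.diagonal_one, ← Matrix.diagonal_smul]; congr 1; ext; simp; norm_num
  have e3 : (Matrix.diagonal (1 : Fin N ⊕ Fin N → ℂ)) = 1 := Matrix.diagonal_one
  rw [cj_def, e, e3, mul_one, e0, sub_self, diag_zero'] at h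
  rw [h]
  simp only [Matrix.mul_smul, Matrix.smul_mul, mul_one, Matrix.mul_zero, Matrix.zero_mul, mC_mul_mD,
    ← Matrix.transpose_mul, Matrix.transpose_one]
  rw [Matrix.fromBlocks_smul, smul_smul, smul_zero]
  norm_num

theorem cj_pow (s : ℝ) (N : ℕ) (m) (n : ℕ) : cj s N m ^ n = cj s N (m ^ n) := by
  induction n with
  | zero =>
    have e3 : (Matrix.diagonal (1 : Fin N ⊕ Fin N → ℂ)) = 1 := Matrix.diagonal_one
    rw [pow_zero, pow_zero, cj_def, e3, mul_one, mul_eq_one_comm.1 (mV_mul_mW s N)]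
  | succ n ih =>
    rw [pow_succ, ih, cj_def, cj_def, cj_def, pow_succ]
    calc _ = mW s N * Matrix.diagonal (m ^ n) * (mV s N * mW s N) * Matrix.diagonal m * mV s N := by
          simp only [mul_assoc]
      _ = _ := by
          rw [mV_mul_mW, mul_one, mul_assoc (mW s N), Matrix.diagonal_mul_diagonal]; rfl

theorem cj_aeval (s : ℝ) (N : ℕ) (m) (φ : Polynomial ℂ) :
    aeval (cj s N m) φ = cj s N (fun i => φ.eval (m i)) := by
  rw [aeval_eq_sum_range]
  have : (fun i => φ.eval (m i)) = ∑ k ∈ Finset.range (φ.natDegree + 1), φ.coeff k • m ^ k := by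
    ext i
    rw [Polynomial.eval_eq_sum_range]
    simp
  rw [this, map_sum]
  refine Finset.sum_congr rfl fun k _ => ?_
  rw [cj_pow, map_smul]

/-- norm of the partial sum projections. -/
theorem cj_cut_norm (s : ℝ) (hs0 : 0 < s) (hs1 : s < 1 / 2) (N n : ℕ) (hn : n ≤ N) :
    ‖cj s N (Sum.elim (cut N n) (cut N n))‖ ≤ cSch s := by
  have hC0 : 0 ≤ cSch s := by
    unfold cSch
    have p1 : 0 < 1 - (1 / 2 - s) := by linarith
    have p2 : 0 < 1 / 2 - s := by linarith
    have p3 : 0 < 1 - (1 / 2 + s) := by linarith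
    have p4 : 0 < 1 / 2 + s := by linarith
    positivity
  set Q := mC s N * Matrix.diagonal (cut N n) * mD s N with hQ
  have h : cj s N (Sum.elim (cut N n) (cut N n)) = Matrix.fromBlocks Q 0 0 Qᵀ := by
    rw [cj_elim, sub_self, diag_zero']
    have e0 : Matrix.diagonal (cut N n + cut N n) = (2:ℂ) • Matrix.diagonal (cut N n) := by
      rw [← Matrix.diagonal_smul]; congr 1; ext; simp; ring
    rw [e0]
    simp only [Matrix.mul_smul, Matrix.smul_mul, Matrix.mul_zero, Matrix.zero_mul]
    rw [Matrix.fromBlocks_smul, smul_smul, smul_smul, smul_zero]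
    norm_num
    rw [hQ, Matrix.transpose_mul, Matrix.transpose_mul, Matrix.diagonal_transpose, mul_assoc]
    exact ⟨rfl, mul_assoc _ _ _⟩
  obtain ⟨r, rfl⟩ := Nat.exists_eq_add_of_le hn
  have en : ∀ i j, ‖Q i j‖ = |qN s n i j| := fun i j => by
    rw [hQ, mQ_entry s _ n hn i j, Complex.norm_real, Real.norm_eq_abs]
  rw [h]
  refine schur_test _ (Sum.elim (fun i : Fin (n + r) => omg n i) (fun i : Fin (n + r) => omg n i)) ?_ _ hC0 ?_ ?_
  · rintro (i | i) <;> exact omg_pos n i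
  · rintro (i | i)
    · simp only [Fintype.sum_sum_type, Matrix.fromBlocks_apply₁₁, Matrix.fromBlocks_apply₁₂, Sum.elim_inl,
        Sum.elim_inr, Matrix.zero_apply, norm_zero, zero_mul, Finset.sum_const_zero, add_zero, en]
      rw [Fin.sum_univ_eq_sum_range (fun j => |qN s n i j| * omg n j)]
      exact schur_row s hs0 hs1 n r i i.2
    · simp only [Fintype.sum_sum_type, Matrix.fromBlocks_apply₂₁, Matrix.fromBlocks_apply₂₂, Sum.elim_inl,
        Sum.elim_inr, Matrix.zero_apply, norm_zero, zero_mul, Finset.sum_const_zero, zero_add,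
        Matrix.transpose_apply, en]
      rw [Fin.sum_univ_eq_sum_range (fun j => |qN s n j i| * omg n j)]
      exact schur_col s hs0 hs1 n r i i.2
  · rintro (i | i)
    · simp only [Fintype.sum_sum_type, Matrix.fromBlocks_apply₁₁, Matrix.fromBlocks_apply₂₁, Sum.elim_inl,
        Sum.elim_inr, Matrix.zero_apply, norm_zero, zero_mul, Finset.sum_const_zero, add_zero, en]
      rw [Fin.sum_univ_eq_sum_range (fun j => |qN s n j i| * omg n j)]
      exact schur_col s hs0 hs1 n r i i.2
    · simp only [Fintype.sum_sum_type, Matrix.fromBlocks_apply₁₂, Matrix.fromBlocks_apply₂₂, Sum.elim_inl,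
        Sum.elim_inr, Matrix.zero_apply, norm_zero, zero_mul, Finset.sum_const_zero, zero_add,
        Matrix.transpose_apply, en]
      rw [Fin.sum_univ_eq_sum_range (fun j => |qN s n i j| * omg n j)]
      exact schur_row s hs0 hs1 n r i i.2

end MatrixPart

/-! ### Part 4d: norm estimates for the diagonal calculus -/

section MatrixPart2

open scoped Matrix Matrix.Norms.L2Operator

noncomputable def cPr (s : ℝ) : ℝ := 2 * (2 + 1 / (1 - 2 * s))

theorem sum_col_sq (s : ℝ) (hs0 : 0 < s) (hs1 : s < 1 / 2) (N : ℕ) (k : Fin N) :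
    ∑ i, ‖mC s N i k‖ ^ 2 + ∑ i, ‖mD s N k i‖ ^ 2 ≤ cPr s := by
  have h1 : ∑ i, ‖mC s N i k‖ ^ 2 ≤ 2 + 1 / (1 - 2 * s) := by
    have e : ∀ i : Fin N, ‖mC s N i k‖ ^ 2 = (fun i : ℕ => if (k : ℕ) ≤ i then cS s (i - k) ^ 2 else 0) i := by
      intro i
      simp only [mC]
      split_ifs <;> simp
    rw [Finset.sum_congr rfl fun i _ => e i, Fin.sum_univ_eq_sum_range (fun i : ℕ => if (k : ℕ) ≤ i then cS s (i - k) ^ 2 else 0)]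
    obtain ⟨r, hr⟩ := Nat.exists_eq_add_of_le k.2.le
    rw [show Finset.range N = Finset.range (k + r) by rw [← hr], Finset.sum_range_add]
    have z : ∑ x ∈ Finset.range (k : ℕ), (if (k : ℕ) ≤ x then cS s (x - k) ^ 2 else 0) = 0 :=
      Finset.sum_eq_zero fun x hx => by
        rw [Finset.mem_range] at hx
        rw [if_neg (by omega)]
    rw [z, zero_add]
    simp only [le_add_iff_nonneg_right, zero_le, if_true, Nat.add_sub_cancel_left]
    exact sum_sq_le s hs0 hs1 r (cS s) rfl (abs_cS_le s hs0.le hs1.le)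
  have h2 : ∑ i, ‖mD s N k i‖ ^ 2 ≤ 2 + 1 / (1 - 2 * s) := by
    have e : ∀ i : Fin N, ‖mD s N k i‖ ^ 2 = (fun i : ℕ => if i ≤ (k : ℕ) then dS s (k - i) ^ 2 else 0) i := by
      intro i
      simp only [mD]
      split_ifs <;> simp
    rw [Finset.sum_congr rfl fun i _ => e i, Fin.sum_univ_eq_sum_range (fun i : ℕ => if i ≤ (k : ℕ) then dS s (k - i) ^ 2 else 0)]
    obtain ⟨r, hr⟩ := Nat.exists_eq_add_of_le (Nat.succ_le_of_lt k.2)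
    rw [show Finset.range N = Finset.range ((k : ℕ).succ + r) by rw [← hr], Finset.sum_range_add]
    have z : ∑ x ∈ Finset.range r, (if (k : ℕ).succ + x ≤ (k : ℕ) then dS s (k - ((k : ℕ).succ + x)) ^ 2 else 0) = 0 :=
      Finset.sum_eq_zero fun x hx => by
        rw [if_neg (by omega)]
    rw [z, add_zero, ← Finset.sum_range_reflect]
    have : ∀ j ∈ Finset.range (k : ℕ).succ, (if (k : ℕ).succ - 1 - j ≤ (k : ℕ) then
        dS s (k - ((k : ℕ).succ - 1 - j)) ^ 2 else 0) = dS s j ^ 2 := by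
      intro j hj
      rw [Finset.mem_range] at hj
      rw [if_pos (by omega), show (k : ℕ) - ((k : ℕ).succ - 1 - j) = j by omega]
    rw [Finset.sum_congr rfl this]
    exact sum_sq_le s hs0 hs1 _ (dS s) rfl (abs_dS_le s hs0.le hs1.le)
  unfold cPr
  linarith

noncomputable def uni (N k : ℕ) : Fin N → ℂ := fun i => if (i : ℕ) = k then 1 else 0

theorem cj_uni_norm (s : ℝ) (hs0 : 0 < s) (hs1 : s < 1 / 2) (N k : ℕ) (hk : k < N) :
    ‖cj s N (Sum.elim (uni N k) 0)‖ ≤ cPr s := by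
  have hs := sum_col_sq s hs0 hs1 N ⟨k, hk⟩
  refine rank_one_norm _ (fun i => mW s N i (Sum.inl ⟨k, hk⟩)) (fun j => mV s N (Sum.inl ⟨k, hk⟩) j) _ ?_ ?_ ?_
  · intro i j
    rw [cj_def, Matrix.mul_apply, Fintype.sum_sum_type]
    simp only [Matrix.mul_diagonal, Sum.elim_inl, Sum.elim_inr, Pi.zero_apply, mul_zero, zero_mul,
      Finset.sum_const_zero, add_zero]
    rw [Finset.sum_eq_single ⟨k, hk⟩]
    · simp [uni]
    · intro b _ hb
      have : ¬ (b : ℕ) = k := fun h => hb (Fin.ext h)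
      simp [uni, this]
    · simp
  · rw [Fintype.sum_sum_type]
    simpa [mW] using hs
  · rw [Fintype.sum_sum_type]
    simp only [mV, Matrix.smul_apply, Matrix.fromBlocks_apply₁₁, Matrix.fromBlocks_apply₁₂,
      Matrix.transpose_apply, norm_smul, mul_pow, ← Finset.mul_sum]
    have a1 : 0 ≤ ∑ i, ‖mC s N i ⟨k, hk⟩‖ ^ 2 := Finset.sum_nonneg fun _ _ => by positivity
    have a2 : 0 ≤ ∑ i, ‖mD s N ⟨k, hk⟩ i‖ ^ 2 := Finset.sum_nonneg fun _ _ => by positivity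
    have e : ‖(1 / 2 : ℂ)‖ = 1 / 2 := by simp
    rw [e]
    linarith

theorem abel_norm {A : Type*} [NormedAddCommGroup A] [NormedSpace ℂ A] (R : ℕ → A) (h : ℕ → ℝ) (M : ℝ)
    (hM : 0 ≤ M) (hR0 : R 0 = 0) (N : ℕ) (hR : ∀ n ≤ N, ‖R n‖ ≤ M) :
    ‖∑ k ∈ Finset.range N, (h k : ℂ) • (R (k + 1) - R k)‖ ≤
      M * (|h N| + ∑ k ∈ Finset.range N, |h (k + 1) - h k|) := by
  have e : ∀ n, ∑ k ∈ Finset.range n, (h k : ℂ) • (R (k + 1) - R k) =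
      (h n : ℂ) • R n - ∑ k ∈ Finset.range n, ((h (k + 1) - h k : ℝ) : ℂ) • R (k + 1) := by
    intro n
    induction n with
    | zero => simp [hR0]
    | succ n ih =>
      rw [Finset.sum_range_succ, ih, Finset.sum_range_succ]
      push_cast
      module
  rw [e, mul_add, Finset.mul_sum]
  refine (norm_sub_le _ _).trans (add_le_add ?_ ((norm_sum_le _ _).trans (Finset.sum_le_sum fun k hk => ?_)))
  · rw [norm_smul, Complex.norm_real, Real.norm_eq_abs, mul_comm]
    gcongr
    exact hR N le_rfl
  · rw [Finset.mem_range] at hk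
    rw [norm_smul, Complex.norm_real, Real.norm_eq_abs, mul_comm]
    gcongr
    exact hR (k + 1) hk

theorem cSch_nonneg (s : ℝ) (hs0 : 0 < s) (hs1 : s < 1 / 2) : 0 ≤ cSch s := by
  unfold cSch
  have p1 : 0 < 1 - (1 / 2 - s) := by linarith
  have p2 : 0 < 1 / 2 - s := by linarith
  have p3 : 0 < 1 - (1 / 2 + s) := by linarith
  have p4 : 0 < 1 / 2 + s := by linarith
  positivity

theorem cPr_nonneg (s : ℝ) (hs1 : s < 1 / 2) : 0 ≤ cPr s := by
  unfold cPr
  have p1 : 0 < 1 - 2 * s := by linarith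
  positivity

/-- spread a sequence over the index set. -/
noncomputable def spr (N : ℕ) (g : ℕ → ℝ) : Fin N ⊕ Fin N → ℂ :=
  Sum.elim (fun k => (g (2 * k) : ℂ)) (fun k => (g (2 * k + 1) : ℂ))

theorem spr_eq (N : ℕ) (g : ℕ → ℝ) : spr N g =
    ∑ k ∈ Finset.range N, (g (2 * k + 1) : ℂ) • (Sum.elim (cut N (k + 1)) (cut N (k + 1)) -
      Sum.elim (cut N k) (cut N k)) +
    ∑ k ∈ Finset.range N, ((g (2 * k) - g (2 * k + 1) : ℝ) : ℂ) • Sum.elim (uni N k) 0 := by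
  have hc : ∀ (i : Fin N) (k : ℕ), cut N (k + 1) i - cut N k i = if (i : ℕ) = k then 1 else 0 := by
    intro i k
    unfold cut
    rcases lt_trichotomy (i : ℕ) k with h | h | h
    · rw [if_pos (by omega), if_pos h, if_neg (by omega)]; simp
    · rw [if_pos (by omega), if_neg (by omega), if_pos h]; simp
    · rw [if_neg (by omega), if_neg (by omega), if_neg (by omega)]; simp
  ext i
  rcases i with i | i
  · simp [spr, hc, uni, Finset.sum_ite_eq]
  · simp [spr, hc, uni, Finset.sum_ite_eq]

theorem cj_spr_norm (s : ℝ) (hs0 : 0 < s) (hs1 : s < 1 / 2) (N : ℕ) (g : ℕ → ℝ) :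
    ‖cj s N (spr N g)‖ ≤
      cSch s * (|g (2 * N + 1)| + ∑ k ∈ Finset.range N, |g (2 * (k + 1) + 1) - g (2 * k + 1)|) +
      cPr s * ∑ k ∈ Finset.range N, |g (2 * k) - g (2 * k + 1)| := by
  rw [spr_eq, map_add, map_sum, map_sum]
  refine (norm_add_le _ _).trans (add_le_add ?_ ?_)
  · simp only [map_smul, map_sub]
    refine abel_norm (fun n => cj s N (Sum.elim (cut N n) (cut N n))) (fun k => g (2 * k + 1)) _
      (cSch_nonneg s hs0 hs1) ?_ N fun n hn => cj_cut_norm s hs0 hs1 N n hn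
    have : Sum.elim (cut N 0) (cut N 0) = 0 := by
      ext i; rcases i with i | i <;> simp [cut]
    simp only [this, map_zero]
  · rw [Finset.mul_sum]
    refine (norm_sum_le _ _).trans (Finset.sum_le_sum fun k hk => ?_)
    rw [Finset.mem_range] at hk
    rw [map_smul, norm_smul, Complex.norm_real, Real.norm_eq_abs, mul_comm]
    gcongr
    exact cj_uni_norm s hs0 hs1 N k hk

theorem cj_lower (s : ℝ) (hs0 : 0 < s) (hs1 : s < 1 / 2) (N : ℕ) (hN : 1 ≤ N) (g : ℕ → ℝ)
    (hg : ∀ k < N, 1 / 2 ≤ g (2 * k) - g (2 * k + 1)) :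
    (N : ℝ) ^ (2 * s) / 8 ≤ ‖cj s N (spr N g)‖ := by
  have hN' : (0:ℝ) < N := by exact_mod_cast hN
  set M := cj s N (spr N g) with hM
  set D := mD s N with hD
  have hD1 : ∀ k : Fin N, (D *ᵥ (1 : Fin N → ℂ)) k = (aS s k : ℂ) := by
    intro k
    rw [Matrix.mulVec, dotProduct, ← sum_dS]
    have e : ∀ i : Fin N, D k i * (1 : Fin N → ℂ) i = (fun i : ℕ => if i ≤ (k : ℕ) then (dS s (k - i) : ℂ) else 0) i := by
      intro i; simp [hD, mD]
    rw [Finset.sum_congr rfl fun i _ => e i, Fin.sum_univ_eq_sum_range (fun i : ℕ => if i ≤ (k : ℕ) then (dS s (k - i) : ℂ) else 0)]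
    obtain ⟨r, hr⟩ := Nat.exists_eq_add_of_le (Nat.succ_le_of_lt k.2)
    rw [show Finset.range N = Finset.range ((k : ℕ).succ + r) by rw [← hr], Finset.sum_range_add]
    have z : ∑ x ∈ Finset.range r, (if (k : ℕ).succ + x ≤ (k : ℕ) then (dS s (k - ((k : ℕ).succ + x)) : ℂ) else 0) = 0 :=
      Finset.sum_eq_zero fun x hx => by
        rw [if_neg (by omega)]
    rw [z, add_zero, ← Finset.sum_range_reflect, Complex.ofReal_sum]
    refine Finset.sum_congr rfl fun j hj => ?_
    rw [Finset.mem_range] at hj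
    rw [if_pos (by omega), show (k : ℕ) - ((k : ℕ).succ - 1 - j) = j by omega]
  set x : EuclideanSpace ℂ (Fin N ⊕ Fin N) := WithLp.toLp 2 (Sum.elim 1 0) with hx
  set y : EuclideanSpace ℂ (Fin N ⊕ Fin N) := WithLp.toLp 2 (Sum.elim 0 1) with hy
  have hnx : ‖x‖ = Real.sqrt N := by
    rw [EuclideanSpace.norm_eq, hx]; simp
  have hny : ‖y‖ = Real.sqrt N := by
    rw [EuclideanSpace.norm_eq, hy]; simp
  have hin : inner ℂ y (Matrix.toEuclideanCLM (n := Fin N ⊕ Fin N) (𝕜 := ℂ) M x) =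
      ((1 / 2 * ∑ k ∈ Finset.range N, (g (2 * k) - g (2 * k + 1)) * aS s k ^ 2 : ℝ) : ℂ) := by
    rw [PiLp.inner_apply, Fintype.sum_sum_type, Matrix.ofLp_toEuclideanCLM]
    simp only [hx, hy, Sum.elim_inl, Sum.elim_inr, Pi.zero_apply, Pi.one_apply]
    rw [hM, spr, cj_elim, Matrix.smul_mulVec, Matrix.fromBlocks_mulVec]
    set a : Fin N → ℂ := fun k => (g (2 * k) : ℂ)
    set b : Fin N → ℂ := fun k => (g (2 * k + 1) : ℂ)
    have key : ∑ i, (((D)ᵀ * Matrix.diagonal (a - b) * D) *ᵥ (1 : Fin N → ℂ)) i =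
        ∑ k : Fin N, (a k - b k) * (aS s k : ℂ) ^ 2 := by
      have : ∑ i, (((D)ᵀ * Matrix.diagonal (a - b) * D) *ᵥ (1 : Fin N → ℂ)) i =
          (1 : Fin N → ℂ) ⬝ᵥ (((D)ᵀ * Matrix.diagonal (a - b) * D) *ᵥ (1 : Fin N → ℂ)) := by
        simp [dotProduct]
      rw [this, ← Matrix.mulVec_mulVec, ← Matrix.mulVec_mulVec, Matrix.dotProduct_mulVec,
        Matrix.vecMul_transpose, dotProduct]
      refine Finset.sum_congr rfl fun k _ => ?_
      rw [Matrix.mulVec_diagonal, hD1, Pi.sub_apply]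
      ring
    rw [← hD]
    simp
    rw [← Finset.mul_sum, key, ← Fin.sum_univ_eq_sum_range (fun k => ((g (2 * k) : ℂ) - g (2 * k + 1)) * (aS s k : ℂ) ^ 2)]
  have h1 := norm_inner_le_norm (𝕜 := ℂ) y (Matrix.toEuclideanCLM (n := Fin N ⊕ Fin N) (𝕜 := ℂ) M x)
  have h2 := ContinuousLinearMap.le_opNorm (Matrix.toEuclideanCLM (n := Fin N ⊕ Fin N) (𝕜 := ℂ) M) x
  rw [← Matrix.cstar_norm_def] at h2
  have h3 : (1 / 4) * ∑ k ∈ Finset.range N, ((k : ℝ) + 1) ^ (2 * s) ≤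
      1 / 2 * ∑ k ∈ Finset.range N, (g (2 * k) - g (2 * k + 1)) * aS s k ^ 2 := by
    rw [Finset.mul_sum, Finset.mul_sum]
    refine Finset.sum_le_sum fun k hk => ?_
    rw [Finset.mem_range] at hk
    have a1 := hg k hk
    have a2 := aS_ge s hs0.le (by linarith) k
    have a3 : ((k : ℝ) + 1) ^ (2 * s) ≤ aS s k ^ 2 := by
      rw [mul_comm 2 s, Real.rpow_mul (by positivity), Real.rpow_two]
      gcongr
    have a4 : 0 ≤ ((k : ℝ) + 1) ^ (2 * s) := by positivity
    nlinarith
  rw [hin, Complex.norm_real, hny] at h1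
  rw [hnx] at h2
  have h4 := (le_abs_self _).trans h1
  have h5 := sum_pow_ge s hs0.le hs1.le N
  rw [Real.rpow_add hN', Real.rpow_one] at h5
  have h6 : Real.sqrt N * Real.sqrt N = N := Real.mul_self_sqrt hN'.le
  have h7 : Real.sqrt N * ‖Matrix.toEuclideanCLM (n := Fin N ⊕ Fin N) (𝕜 := ℂ) M x‖ ≤ N * ‖M‖ := by
    calc _ ≤ Real.sqrt N * (‖M‖ * Real.sqrt N) := by gcongr
      _ = (Real.sqrt N * Real.sqrt N) * ‖M‖ := by ring
      _ = _ := by rw [h6]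
  have h8 : (N : ℝ) * ((N : ℝ) ^ (2 * s) / 8) ≤ N * ‖M‖ := by linarith
  exact le_of_mul_le_mul_left h8 hN'

end MatrixPart2

/-! ### Part 4e: the block operators -/

section MatrixPart3

open scoped Matrix Matrix.Norms.L2Operator

theorem one_step_bound (d : ℝ) (h0 : 0 ≤ d) (h1 : d ≤ 1) (a : ℕ) :
    ((a : ℝ) + 1) * d * (1 - d) ^ a ≤ 1 := by
  have e : ∀ n : ℕ, ∑ k ∈ Finset.range n, d * (1 - d) ^ k = 1 - (1 - d) ^ n := by
    intro n
    induction n with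
    | zero => simp
    | succ n ih => rw [Finset.sum_range_succ, ih, pow_succ]; ring
  have h2 : ∑ k ∈ Finset.range (a + 1), d * (1 - d) ^ a ≤ ∑ k ∈ Finset.range (a + 1), d * (1 - d) ^ k := by
    refine Finset.sum_le_sum fun k hk => ?_
    rw [Finset.mem_range] at hk
    exact mul_le_mul_of_nonneg_left (pow_le_pow_of_le_one (by linarith) (by linarith) (by omega)) h0
  rw [e, Finset.sum_const, Finset.card_range, nsmul_eq_mul] at h2
  push_cast at h2
  have : 0 ≤ (1 - d) ^ (a + 1) := pow_nonneg (by linarith) _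
  linarith

theorem two_step_bound (d : ℝ) (h0 : 0 ≤ d) (h1 : d ≤ 1) (a : ℕ) :
    (((a : ℝ) + 1) * d) ^ 2 * (1 - d) ^ a ≤ 4 := by
  obtain ⟨b, c, rfl, hbc, hcb⟩ : ∃ b c, a = b + c ∧ b ≤ c + 1 ∧ c ≤ b + 1 :=
    ⟨a / 2, a - a / 2, by omega, by omega, by omega⟩
  have hb := one_step_bound d h0 h1 b
  have hc := one_step_bound d h0 h1 c
  have p : 0 ≤ 1 - d := by linarith
  have hb0 : 0 ≤ ((b : ℝ) + 1) * d * (1 - d) ^ b := by positivity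
  have hc0 : 0 ≤ ((c : ℝ) + 1) * d * (1 - d) ^ c := by positivity
  have hm : (((b : ℝ) + 1) * d * (1 - d) ^ b) * (((c : ℝ) + 1) * d * (1 - d) ^ c) ≤ 1 := by nlinarith
  have h3 : (((b + c : ℕ) : ℝ) + 1) ^ 2 ≤ 4 * (((b : ℝ) + 1) * ((c : ℝ) + 1)) := by
    have h4 : (b : ℝ) ≤ c + 1 := by exact_mod_cast hbc
    have h5 : (c : ℝ) ≤ b + 1 := by exact_mod_cast hcb
    push_cast
    nlinarith [b.cast_nonneg (α := ℝ), c.cast_nonneg (α := ℝ)]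
  calc _ = (((b + c : ℕ) : ℝ) + 1) ^ 2 * (d ^ 2 * (1 - d) ^ (b + c)) := by ring
    _ ≤ 4 * (((b : ℝ) + 1) * ((c : ℝ) + 1)) * (d ^ 2 * (1 - d) ^ (b + c)) := by gcongr
    _ = 4 * ((((b : ℝ) + 1) * d * (1 - d) ^ b) * (((c : ℝ) + 1) * d * (1 - d) ^ c)) := by
      rw [pow_add]; ring
    _ ≤ 4 := by linarith

/-- the multiplier of `n (T^n - T^(n-1))` with `n = a + 1`. -/
noncomputable def gR (a j : ℕ) : ℝ := ((a : ℝ) + 1) * (lamE j ^ (a + 1) - lamE j ^ a)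

theorem abs_gR (a j : ℕ) : |gR a j| = ((a : ℝ) + 1) * ((8 : ℝ) ^ (2 * j + 1))⁻¹ * lamE j ^ a := by
  have h := pow_nonneg (lamE_nonneg j) a
  have e : gR a j = -(((a : ℝ) + 1) * ((8 : ℝ) ^ (2 * j + 1))⁻¹ * lamE j ^ a) := by
    unfold gR
    rw [pow_succ, show lamE j ^ a * lamE j - lamE j ^ a = lamE j ^ a * (lamE j - 1) by ring]
    conv_lhs => rw [show lamE j - 1 = -((8 : ℝ) ^ (2 * j + 1))⁻¹ by unfold lamE; ring]
    ring
  rw [e, abs_neg, abs_of_nonneg (by positivity)]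

theorem sum_gR (a e J : ℕ) : ∑ k ∈ Finset.range J, |gR a (2 * k + e)| ≤ 16 := by
  rw [← Finset.sum_range_reflect]
  set y : ℝ := ((a : ℝ) + 1) * ((8 : ℝ) ^ (2 * (2 * (J - 1) + e) + 1))⁻¹ with hy
  have hy0 : 0 < y := by positivity
  have hd : ∀ j < J, ((a : ℝ) + 1) * ((8 : ℝ) ^ (2 * (2 * (J - 1 - j) + e) + 1))⁻¹ = y * (4096:ℝ) ^ j := by
    intro j hj
    have e1 : 2 * (2 * (J - 1) + e) + 1 = (2 * (2 * (J - 1 - j) + e) + 1) + 4 * j := by omega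
    have e2 : ∀ X : ℕ, (8:ℝ) ^ (X + 4 * j) = 8 ^ X * 4096 ^ j := by
      intro X
      rw [pow_add, pow_mul (8:ℝ) 4 j]; norm_num
    rw [hy, e1, e2, mul_inv]
    generalize (8:ℝ) ^ (2 * (2 * (J - 1 - j) + e) + 1) = Y
    field_simp
  have hg := geo_sum 4096 (by norm_num) y hy0
    (fun j => if j < J then |gR a (2 * (J - 1 - j) + e)| / 4 else 0) ?_ ?_ J
  · have : ∑ j ∈ Finset.range J, (if j < J then |gR a (2 * (J - 1 - j) + e)| / 4 else 0) =
        (∑ j ∈ Finset.range J, |gR a (2 * (J - 1 - j) + e)|) / 4 := by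
      rw [Finset.sum_div]
      refine Finset.sum_congr rfl fun j hj => ?_
      rw [if_pos (Finset.mem_range.1 hj)]
    rw [this] at hg
    linarith
  · intro j
    split_ifs with hj
    · rw [abs_gR, hd j hj]
      have h1 := pow_le_one₀ (n := a) (lamE_nonneg (2 * (J - 1 - j) + e)) (lamE_lt_one (2 * (J - 1 - j) + e)).le
      have h2 : 0 < y * 4096 ^ j := by positivity
      have h3 := pow_nonneg (lamE_nonneg (2 * (J - 1 - j) + e)) a
      nlinarith
    · positivity
  · intro j
    split_ifs with hj
    · have hb := two_step_bound (((8 : ℝ) ^ (2 * (2 * (J - 1 - j) + e) + 1))⁻¹) (by positivity)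
        (inv_le_one_of_one_le₀ (one_le_pow₀ (by norm_num))) a
      rw [hd j hj] at hb
      change _ * (lamE (2 * (J - 1 - j) + e)) ^ a ≤ 4 at hb
      rw [abs_gR, hd j hj]
      have h2 : 0 < y * 4096 ^ j := by positivity
      rw [le_div_iff₀ h2]
      nlinarith
    · positivity

theorem cj_pow_norm (s : ℝ) (hs0 : 0 < s) (hs1 : s < 1 / 2) (N n : ℕ) :
    ‖cj s N (spr N lamE) ^ n‖ ≤ 2 * cSch s + cPr s := by
  have hl1 : ∀ j, lamE j ^ n ≤ 1 := fun j => pow_le_one₀ (lamE_nonneg _) (lamE_lt_one _).le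
  have hl0 : ∀ j, 0 ≤ lamE j ^ n := fun j => pow_nonneg (lamE_nonneg _) _
  have hm : Monotone fun j => lamE j ^ n :=
    monotone_nat_of_le_succ fun j => pow_le_pow_left₀ (lamE_nonneg _) (lamE_mono j) n
  rw [cj_pow]
  have e : spr N lamE ^ n = spr N (fun j => lamE j ^ n) := by
    ext i; rcases i with i | i <;> simp [spr]
  rw [e]
  refine (cj_spr_norm s hs0 hs1 N _).trans ?_
  have a1 : |lamE (2 * N + 1) ^ n| ≤ 1 := by rw [abs_of_nonneg (hl0 _)]; exact hl1 _
  have a2 : ∑ k ∈ Finset.range N, |lamE (2 * (k + 1) + 1) ^ n - lamE (2 * k + 1) ^ n| ≤ 1 := by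
    have : ∀ k ∈ Finset.range N, |lamE (2 * (k + 1) + 1) ^ n - lamE (2 * k + 1) ^ n| =
        (fun k => lamE (2 * k + 1) ^ n) (k + 1) - (fun k => lamE (2 * k + 1) ^ n) k := fun k _ =>
      abs_of_nonneg (sub_nonneg.2 (hm (by omega)))
    rw [Finset.sum_congr rfl this, Finset.sum_range_sub (fun k => lamE (2 * k + 1) ^ n)]
    have := hl1 (2 * N + 1)
    have := hl0 (2 * 0 + 1)
    linarith
  have a3 : ∑ k ∈ Finset.range N, |lamE (2 * k) ^ n - lamE (2 * k + 1) ^ n| ≤ 1 := by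
    have : ∀ k ∈ Finset.range N, |lamE (2 * k) ^ n - lamE (2 * k + 1) ^ n| ≤
        (fun k => lamE (2 * k) ^ n) (k + 1) - (fun k => lamE (2 * k) ^ n) k := fun k _ => by
      rw [abs_sub_comm, abs_of_nonneg (sub_nonneg.2 (hm (by omega)))]
      exact sub_le_sub_right (hm (by omega)) _
    refine (Finset.sum_le_sum this).trans ?_
    rw [Finset.sum_range_sub (fun k => lamE (2 * k) ^ n)]
    have := hl1 (2 * N)
    have := hl0 (2 * 0)
    linarith
  have b1 := cSch_nonneg s hs0 hs1
  have b2 := cPr_nonneg s hs1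
  nlinarith

theorem cj_ritt_norm (s : ℝ) (hs0 : 0 < s) (hs1 : s < 1 / 2) (N n : ℕ) (hn : 1 ≤ n) :
    (n : ℝ) * ‖cj s N (spr N lamE) ^ n - cj s N (spr N lamE) ^ (n - 1)‖ ≤ 48 * cSch s + 32 * cPr s := by
  obtain ⟨a, rfl⟩ : ∃ a, n = a + 1 := ⟨n - 1, by omega⟩
  rw [cj_pow, cj_pow, ← map_sub, Nat.add_sub_cancel]
  have e : ((a + 1 : ℕ) : ℂ) • (spr N lamE ^ (a + 1) - spr N lamE ^ a) = spr N (gR a) := by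
    ext i; rcases i with i | i <;> simp [spr, gR]
  have e2 : ((a + 1 : ℕ) : ℝ) * ‖cj s N (spr N lamE ^ (a + 1) - spr N lamE ^ a)‖ = ‖cj s N (spr N (gR a))‖ := by
    rw [← e, map_smul, norm_smul, Complex.norm_natCast]
  rw [e2]
  refine (cj_spr_norm s hs0 hs1 N _).trans ?_
  have s0 := sum_gR a 0 N
  have s1 := sum_gR a 1 N
  have s3 := sum_gR a 3 N
  have a1 : |gR a (2 * N + 1)| ≤ 16 := by
    have := sum_gR a 1 (N + 1)
    rw [Finset.sum_range_succ] at this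
    have h0 : 0 ≤ ∑ k ∈ Finset.range N, |gR a (2 * k + 1)| := Finset.sum_nonneg fun _ _ => abs_nonneg _
    linarith
  have a2 : ∑ k ∈ Finset.range N, |gR a (2 * (k + 1) + 1) - gR a (2 * k + 1)| ≤ 32 := by
    calc _ ≤ ∑ k ∈ Finset.range N, (|gR a (2 * k + 3)| + |gR a (2 * k + 1)|) := by
          refine Finset.sum_le_sum fun k _ => ?_
          exact abs_sub _ _
      _ ≤ 32 := by rw [Finset.sum_add_distrib]; linarith
  have a3 : ∑ k ∈ Finset.range N, |gR a (2 * k) - gR a (2 * k + 1)| ≤ 32 := by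
    calc _ ≤ ∑ k ∈ Finset.range N, (|gR a (2 * k + 0)| + |gR a (2 * k + 1)|) := by
          refine Finset.sum_le_sum fun k _ => ?_
          exact abs_sub _ _
      _ ≤ 32 := by rw [Finset.sum_add_distrib]; linarith
  have b1 := cSch_nonneg s hs0 hs1
  have b2 := cPr_nonneg s hs1
  nlinarith

theorem block_exists (s : ℝ) (hs0 : 0 < s) (hs1 : s < 1 / 2) : ∃ M : ℝ, ∀ N : ℕ,
    ∃ T : EuclideanSpace ℂ (Fin N ⊕ Fin N) →L[ℂ] EuclideanSpace ℂ (Fin N ⊕ Fin N),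
      (∀ n : ℕ, ‖T ^ n‖ ≤ M) ∧ (∀ n : ℕ, 1 ≤ n → (n : ℝ) * ‖T ^ n - T ^ (n - 1)‖ ≤ M) ∧
      (1 ≤ N → (N : ℝ) ^ (2 * s) / 8 ≤ ‖aeval T (testP N)‖) := by
  have b1 := cSch_nonneg s hs0 hs1
  have b2 := cPr_nonneg s hs1
  refine ⟨48 * cSch s + 32 * cPr s, fun N => ⟨Matrix.toEuclideanCLM (n := Fin N ⊕ Fin N) (𝕜 := ℂ)
    (cj s N (spr N lamE)), fun n => ?_, fun n hn => ?_, fun hN => ?_⟩⟩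
  · rw [← map_pow, ← Matrix.cstar_norm_def]
    exact (cj_pow_norm s hs0 hs1 N n).trans (by linarith)
  · have hp : ∀ n, (Matrix.toEuclideanCLM (n := Fin N ⊕ Fin N) (𝕜 := ℂ) (cj s N (spr N lamE))) ^ n =
        Matrix.toEuclideanCLM (n := Fin N ⊕ Fin N) (𝕜 := ℂ) (cj s N (spr N lamE) ^ n) :=
      fun n => (map_pow _ _ _).symm
    rw [hp, hp, ← map_sub, ← Matrix.cstar_norm_def]
    exact cj_ritt_norm s hs0 hs1 N n hn
  · have h : aeval (Matrix.toEuclideanCLM (n := Fin N ⊕ Fin N) (𝕜 := ℂ) (cj s N (spr N lamE))) (testP N) =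
        Matrix.toEuclideanCLM (n := Fin N ⊕ Fin N) (𝕜 := ℂ) (aeval (cj s N (spr N lamE)) (testP N)) :=
      Polynomial.aeval_algHom_apply (Matrix.toEuclideanCLM (n := Fin N ⊕ Fin N) (𝕜 := ℂ)) _ _
    rw [h, ← Matrix.cstar_norm_def, cj_aeval]
    have e : (fun i => (testP N).eval (spr N lamE i)) = spr N (fun j => testR N (lamE j)) := by
      ext i; rcases i with i | i <;> simp [spr, testP_eval_real]
    rw [e]
    exact cj_lower s hs0 hs1 N hN _ fun k hk => testR_gap N k hk

end MatrixPart3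

/-! ### Part 5: direct sums -/

section DirectSum

variable {E : ℕ → Type} [∀ i, NormedAddCommGroup (E i)] [∀ i, InnerProductSpace ℂ (E i)]

theorem lp_norm_le_of_coord (f g : lp E 2) (M : ℝ) (hM : 0 ≤ M) (h : ∀ i, ‖g i‖ ≤ M * ‖f i‖) :
    ‖g‖ ≤ M * ‖f‖ := by
  have h1 : ‖g‖ ≤ ‖(M : ℂ) • f‖ := by
    refine lp.norm_mono (by norm_num) fun i => ?_
    rw [lp.coeFn_smul, Pi.smul_apply, norm_smul, Complex.norm_real, Real.norm_of_nonneg hM]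
    exact h i
  rwa [norm_smul, Complex.norm_real, Real.norm_of_nonneg hM] at h1

theorem memlp_of_coord (f : lp E 2) (g : ∀ i, E i) (M : ℝ) (hM : 0 ≤ M) (h : ∀ i, ‖g i‖ ≤ M * ‖f i‖) :
    Memℓp g 2 := by
  have hf : Memℓp (fun i => ((M : ℂ) • f) i) 2 := lp.memℓp ((M : ℂ) • f)
  refine hf.mono' fun i => ?_
  rw [lp.coeFn_smul, Pi.smul_apply, norm_smul, Complex.norm_real, Real.norm_of_nonneg hM]
  exact h i

/-- the direct sum of a uniformly bounded family of operators -/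
noncomputable def dsum (A : ∀ i, E i →L[ℂ] E i) (M : ℝ) (hM : 0 ≤ M) (hA : ∀ i, ‖A i‖ ≤ M) :
    lp E 2 →L[ℂ] lp E 2 :=
  LinearMap.mkContinuous
    { toFun := fun f => ⟨fun i => A i (f i), memlp_of_coord f _ M hM fun i => (A i).le_of_opNorm_le (hA i) _⟩
      map_add' := fun f g => by
        ext1; funext i
        exact map_add (A i) (f i) (g i)
      map_smul' := fun c f => by
        ext1; funext i
        simp } M
    (fun f => lp_norm_le_of_coord _ _ M hM fun i => (A i).le_of_opNorm_le (hA i) _)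

theorem dsum_apply (A : ∀ i, E i →L[ℂ] E i) (M : ℝ) (hM : 0 ≤ M) (hA : ∀ i, ‖A i‖ ≤ M) (f : lp E 2) (i : ℕ) :
    dsum A M hM hA f i = A i (f i) := rfl

theorem coord_aeval (R : lp E 2 →L[ℂ] lp E 2) (A : ∀ i, E i →L[ℂ] E i) (h : ∀ f i, R f i = A i (f i))
    (φ : Polynomial ℂ) : ∀ f i, aeval R φ f i = aeval (A i) φ (f i) := by
  induction φ using Polynomial.induction_on' with
  | add p q hp hq => intro f i; simp [hp, hq]
  | monomial n a =>
    intro f i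
    have hn : ∀ n : ℕ, ∀ f i, (R ^ n) f i = (A i ^ n) (f i) := by
      intro n
      induction n with
      | zero => intro f i; simp
      | succ n ih => intro f i; rw [pow_succ, pow_succ, ContinuousLinearMap.mul_apply, ih, h]; rfl
    rw [← Polynomial.C_mul_X_pow_eq_monomial, map_mul, map_mul, aeval_C, aeval_C, map_pow, map_pow, aeval_X, aeval_X,
      Algebra.algebraMap_eq_smul_one, Algebra.algebraMap_eq_smul_one, smul_one_mul, smul_one_mul,
      ContinuousLinearMap.smul_apply, ContinuousLinearMap.smul_apply, lp.coeFn_smul, Pi.smul_apply, hn]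

theorem coord_norm_le (R : lp E 2 →L[ℂ] lp E 2) (A : ∀ i, E i →L[ℂ] E i) (h : ∀ f i, R f i = A i (f i))
    (M : ℝ) (hM : 0 ≤ M) (hA : ∀ i, ‖A i‖ ≤ M) : ‖R‖ ≤ M := by
  refine R.opNorm_le_bound hM fun f => lp_norm_le_of_coord _ _ M hM fun i => ?_
  rw [h]
  exact (A i).le_of_opNorm_le (hA i) _

theorem coord_norm_ge (R : lp E 2 →L[ℂ] lp E 2) (A : ∀ i, E i →L[ℂ] E i) (h : ∀ f i, R f i = A i (f i))
    (N : ℕ) : ‖A N‖ ≤ ‖R‖ := by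
  refine (A N).opNorm_le_bound R.opNorm_nonneg fun x => ?_
  have h1 := R.le_opNorm (lp.single 2 N x)
  rw [lp.norm_single (by norm_num)] at h1
  refine le_trans ?_ h1
  have h2 := lp.norm_apply_le_norm (p := 2) (by norm_num) (R (lp.single 2 N x)) N
  rw [h, lp.single_apply_self] at h2
  exact h2

end DirectSum

theorem exists_isometry : Nonempty (lp (fun N : ℕ => EuclideanSpace ℂ (Fin N ⊕ Fin N)) 2 ≃ₗᵢ[ℂ] lp (fun _ : ℕ => ℂ) 2) := by
  classical
  haveI : Infinite (Σ N : ℕ, Fin N ⊕ Fin N) :=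
    Infinite.of_injective (fun n : ℕ => (⟨n + 1, Sum.inl 0⟩ : Σ N : ℕ, Fin N ⊕ Fin N)) fun a b hab => by
      have := congrArg Sigma.fst hab
      simpa using this
  obtain ⟨den⟩ := nonempty_denumerable (Σ N : ℕ, Fin N ⊕ Fin N)
  let e : ℕ ≃ (Σ N : ℕ, Fin N ⊕ Fin N) := (Denumerable.eqv _).symm
  let v : (Σ N : ℕ, Fin N ⊕ Fin N) → lp (fun N : ℕ => EuclideanSpace ℂ (Fin N ⊕ Fin N)) 2 :=
    fun x => lp.single 2 x.1 (EuclideanSpace.single x.2 (1 : ℂ))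
  have hv : Orthonormal ℂ v := by
    rw [orthonormal_iff_ite]
    rintro ⟨N, i⟩ ⟨N', j⟩
    simp only [v]
    rw [lp.inner_single_left]
    by_cases hN : N = N'
    · subst hN
      rw [lp.single_apply_self]
      simp [EuclideanSpace.inner_single_left, Pi.single_apply]
    · rw [lp.single_apply_ne _ _ _ hN, inner_zero_right, if_neg]
      intro h
      exact hN (congrArg Sigma.fst h)
  have hw : Orthonormal ℂ (v ∘ e) := hv.comp _ e.injective
  have hb : (Submodule.span ℂ (Set.range (v ∘ e)))ᗮ = ⊥ := by
    rw [Submodule.eq_bot_iff]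
    intro f hf
    rw [e.surjective.range_comp] at hf
    ext1
    funext N
    ext i
    have h1 := (Submodule.mem_orthogonal _ _).1 hf (v ⟨N, i⟩) (Submodule.subset_span ⟨_, rfl⟩)
    simp only [v] at h1
    rw [lp.inner_single_left] at h1
    simpa [EuclideanSpace.inner_single_left] using h1
  exact ⟨(HilbertBasis.mkOfOrthogonalEqBot hw hb).repr⟩

theorem conj_norm {H K : Type} [NormedAddCommGroup H] [InnerProductSpace ℂ H] [NormedAddCommGroup K]
    [InnerProductSpace ℂ K] (U : H ≃ₗᵢ[ℂ] K) (R : H →L[ℂ] H) (T : K →L[ℂ] K) (h : ∀ x, T (U x) = U (R x)) :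
    ‖T‖ = ‖R‖ := by
  apply le_antisymm
  · refine T.opNorm_le_bound (norm_nonneg _) fun y => ?_
    obtain ⟨x, rfl⟩ := U.surjective y
    rw [h, U.norm_map, U.norm_map]
    exact R.le_opNorm x
  · refine R.opNorm_le_bound (norm_nonneg _) fun x => ?_
    rw [← U.norm_map (R x), ← h, ← U.norm_map x]
    exact T.le_opNorm _

theorem conj_aeval {H K : Type} [NormedAddCommGroup H] [InnerProductSpace ℂ H] [NormedAddCommGroup K]
    [InnerProductSpace ℂ K] (U : H ≃ₗᵢ[ℂ] K) (R : H →L[ℂ] H) (T : K →L[ℂ] K) (h : ∀ x, T (U x) = U (R x))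
    (φ : Polynomial ℂ) : ∀ x, aeval T φ (U x) = U (aeval R φ x) := by
  induction φ using Polynomial.induction_on' with
  | add p q hp hq => intro x; simp [hp, hq]
  | monomial n a =>
    intro x
    have hn : ∀ n : ℕ, ∀ x, (T ^ n) (U x) = U ((R ^ n) x) := by
      intro n
      induction n with
      | zero => intro x; simp
      | succ n ih => intro x; rw [pow_succ, pow_succ, ContinuousLinearMap.mul_apply, h, ih]; rfl
    rw [← Polynomial.C_mul_X_pow_eq_monomial, map_mul, map_mul, aeval_C, aeval_C, map_pow, map_pow, aeval_X, aeval_X,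
      Algebra.algebraMap_eq_smul_one, Algebra.algebraMap_eq_smul_one, smul_one_mul, smul_one_mul,
      ContinuousLinearMap.smul_apply, ContinuousLinearMap.smul_apply, map_smul, hn]

/-- Passage from the blocks to a single operator on `ℓ²`. -/
theorem assemble (A : ∀ N : ℕ, EuclideanSpace ℂ (Fin N ⊕ Fin N) →L[ℂ] EuclideanSpace ℂ (Fin N ⊕ Fin N))
    (M : ℝ) (hA : ∀ N, ‖A N‖ ≤ M) :
    ∃ T : lp (fun _ : ℕ => ℂ) 2 →L[ℂ] lp (fun _ : ℕ => ℂ) 2, ∀ φ : Polynomial ℂ,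
      (∀ B : ℝ, (∀ N, ‖aeval (A N) φ‖ ≤ B) → ‖aeval T φ‖ ≤ B) ∧ ∀ N, ‖aeval (A N) φ‖ ≤ ‖aeval T φ‖ := by
  obtain ⟨U⟩ := exists_isometry
  have hM : 0 ≤ M := (norm_nonneg _).trans (hA 0)
  let R := dsum A M hM hA
  let T : lp (fun _ : ℕ => ℂ) 2 →L[ℂ] lp (fun _ : ℕ => ℂ) 2 :=
    (U.toContinuousLinearEquiv : _ →L[ℂ] _).comp (R.comp (U.symm.toContinuousLinearEquiv : _ →L[ℂ] _))
  have hT : ∀ x, T (U x) = U (R x) := by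
    intro x
    change U (R (U.symm (U x))) = _
    rw [U.symm_apply_apply]
  refine ⟨T, fun φ => ?_⟩
  rw [conj_norm U _ _ (conj_aeval U R T hT φ)]
  have hc := coord_aeval R A (dsum_apply A M hM hA) φ
  exact ⟨fun B hB => coord_norm_le _ (fun i => aeval (A i) φ) hc B ((norm_nonneg _).trans (hB 0)) hB,
    fun N => coord_norm_ge _ (fun i => aeval (A i) φ) hc N⟩

/-- for `1 < p < ∞`, there exists a Ritt operator `T` on `ℓ²` (in particular a
power bounded operator) which is not `p`-polynomially bounded: for every `C ≥ 1` there is a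
polynomial `φ` with `‖φ(T)‖ > C ‖φ(S)‖`, where `S` is the shift on `ℓ^p(ℤ)`. -/
theorem stmt_17 (p : ℝ) (hp : 1 < p) :
    letI : Fact (1 ≤ ENNReal.ofReal p) :=
      ⟨by rw [← ENNReal.ofReal_one]; exact ENNReal.ofReal_le_ofReal hp.le⟩
    ∃ T : lp (fun _ : ℕ => ℂ) 2 →L[ℂ] lp (fun _ : ℕ => ℂ) 2,
      (∃ C : ℝ, ∀ n : ℕ, ‖T ^ n‖ ≤ C) ∧
      (∃ C : ℝ, ∀ n : ℕ, 1 ≤ n → (n : ℝ) * ‖T ^ n - T ^ (n - 1)‖ ≤ C) ∧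
      ∀ C : ℝ, 1 ≤ C → ∃ φ : Polynomial ℂ,
        C * ‖aeval (shiftOp (ENNReal.ofReal p)) φ‖ < ‖aeval T φ‖ := by
  haveI : Fact (1 ≤ ENNReal.ofReal p) := ⟨by rw [← ENNReal.ofReal_one]; exact ENNReal.ofReal_le_ofReal hp.le⟩
  obtain ⟨θ, Cp, hθ0, hθ1, hCp, hshift⟩ := shift_testP_norm p hp
  obtain ⟨M, hM⟩ := block_exists ((1 + θ) / 4) (by linarith) (by linarith)
  choose A hA1 hA2 hA3 using hM
  obtain ⟨T, hT⟩ := assemble A M fun N => by simpa using hA1 N 1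
  refine ⟨T, ⟨M, fun n => ?_⟩, ⟨M, fun n hn => ?_⟩, fun C hC => ?_⟩
  · have h := (hT (X ^ n)).1 M fun N => by simpa using hA1 N n
    simpa using h
  · have hn0 : (0 : ℝ) < n := by exact_mod_cast hn
    have h := (hT (X ^ n - X ^ (n - 1))).1 (M / n) fun N => by
      rw [le_div_iff₀ hn0, mul_comm]
      simpa using hA2 N n hn
    rw [le_div_iff₀ hn0, mul_comm] at h
    simpa using h
  · have ht : Filter.Tendsto (fun N : ℕ => (N : ℝ) ^ ((1 - θ) / 2)) Filter.atTop Filter.atTop :=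
      (tendsto_rpow_atTop (by linarith)).comp tendsto_natCast_atTop_atTop
    obtain ⟨N, hN1, hN⟩ := ((Filter.eventually_ge_atTop 1).and (ht.eventually_gt_atTop (8 * (C * Cp)))).exists
    have hN0 : (0 : ℝ) < N := by exact_mod_cast hN1
    refine ⟨testP N, ?_⟩
    refine lt_of_le_of_lt (mul_le_mul_of_nonneg_left (hshift N hN1) (by linarith)) ?_
    refine lt_of_lt_of_le ?_ ((hA3 N hN1).trans ((hT (testP N)).2 N))
    have e : (N : ℝ) ^ (2 * ((1 + θ) / 4)) = (N : ℝ) ^ ((1 - θ) / 2) * (N : ℝ) ^ θ := by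
      rw [← Real.rpow_add hN0]; congr 1; ring
    rw [e]
    have hpos : 0 < (N : ℝ) ^ θ := Real.rpow_pos_of_pos hN0 _
    have := mul_lt_mul_of_pos_right hN hpos
    linarith
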